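/- arXiv:2110.07706 — 3 statements merged into one kernel-verified Lean document; each statement's English description precedes it below -/
import Mathlib

section
/- There exists a quasi-threshold graph G such that no minimum co-bipartite completion of G is a proper interval graph; in particular, a minimum co-bipartite completion of G may contain an induced C_4. -/
def IsProperIntervalGraph {V : Type*} (G : SimpleGraph V) : Prop :=
  ∃ a b : V → ℝ, (∀ v, a v ≤ b v) ∧
    (∀ u v, G.Adj u v ↔ u ≠ v ∧ a u ≤ b v ∧ a v ≤ b u) ∧
    (∀ u v, a u ≤ a v → b v ≤ b u → a u = a v ∧ b u = b v)

def IsCoBipartite {V : Type*} (G : SimpleGraph V) : Prop :=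
  ∃ s : Set V, G.IsClique s ∧ G.IsClique sᶜ

def HasInducedP4 {V : Type*} (G : SimpleGraph V) : Prop :=
  ∃ a b c d : V, a ≠ b ∧ a ≠ c ∧ a ≠ d ∧ b ≠ c ∧ b ≠ d ∧ c ≠ d ∧
    G.Adj a b ∧ G.Adj b c ∧ G.Adj c d ∧ ¬ G.Adj a c ∧ ¬ G.Adj a d ∧ ¬ G.Adj b d

def HasInducedC4 {V : Type*} (G : SimpleGraph V) : Prop :=
  ∃ a b c d : V, a ≠ b ∧ a ≠ c ∧ a ≠ d ∧ b ≠ c ∧ b ≠ d ∧ c ≠ d ∧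
    G.Adj a b ∧ G.Adj b c ∧ G.Adj c d ∧ G.Adj d a ∧ ¬ G.Adj a c ∧ ¬ G.Adj b d

def IsQuasiThreshold {V : Type*} (G : SimpleGraph V) : Prop :=
  ¬ HasInducedP4 G ∧ ¬ HasInducedC4 G

/-- `H` is a co-bipartite completion of `G` with the fewest possible fill edges. -/
def IsMinCoBipCompletion {V : Type*} [Fintype V] (G H : SimpleGraph V) : Prop :=
  G ≤ H ∧ IsCoBipartite H ∧
    ∀ H' : SimpleGraph V, G ≤ H' → IsCoBipartite H' →
      (H.edgeSet \ G.edgeSet).ncard ≤ (H'.edgeSet \ G.edgeSet).ncard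

theorem HasInducedC4.not_isProperIntervalGraph {V : Type*} {G : SimpleGraph V}
    (h : HasInducedC4 G) : ¬ IsProperIntervalGraph G := by
  rintro ⟨l, r, -, hadj, -⟩
  obtain ⟨a, b, c, d, -, hac, -, -, hbd, -, h1, h2, h3, h4, h5, h6⟩ := h
  rw [hadj] at h1 h2 h3 h4 h5 h6
  obtain ⟨-, h1, h1'⟩ := h1
  obtain ⟨-, h2, h2'⟩ := h2
  obtain ⟨-, h3, h3'⟩ := h3
  obtain ⟨-, h4, h4'⟩ := h4
  have h5 : r c < l a ∨ r a < l c := by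
    by_contra! hc
    exact h5 ⟨hac, hc⟩
  have h6 : r d < l b ∨ r b < l d := by
    by_contra! hc
    exact h6 ⟨hbd, hc⟩
  rcases h5 with h5 | h5 <;> rcases h6 with h6 | h6 <;> linarith

/-- The supergraph of `G` in which both fibres of the colouring `s` are made cliques. -/
def fiberCompletion {V : Type*} (G : SimpleGraph V) (s : V → Bool) : SimpleGraph V where
  Adj u v := u ≠ v ∧ (G.Adj u v ∨ s u = s v)
  symm := ⟨fun _ _ h => ⟨h.1.symm, h.2.imp (fun h => h.symm) Eq.symm⟩⟩
  loopless := ⟨fun _ h => h.1 rfl⟩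

instance {V : Type*} [DecidableEq V] (G : SimpleGraph V) [DecidableRel G.Adj] (s : V → Bool) :
    DecidableRel (fiberCompletion G s).Adj :=
  fun u v => inferInstanceAs (Decidable (u ≠ v ∧ (G.Adj u v ∨ s u = s v)))

theorem le_fiberCompletion {V : Type*} (G : SimpleGraph V) (s : V → Bool) :
    G ≤ fiberCompletion G s :=
  fun _ _ h => ⟨h.ne, Or.inl h⟩

theorem isCoBipartite_fiberCompletion {V : Type*} (G : SimpleGraph V) (s : V → Bool) :
    IsCoBipartite (fiberCompletion G s) := by
  refine ⟨{v | s v = true}, fun u hu v hv huv => ⟨huv, Or.inr ?_⟩,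
    fun u hu v hv huv => ⟨huv, Or.inr ?_⟩⟩ <;> simp_all

theorem IsCoBipartite.exists_fiberCompletion_le {V : Type*} {G H : SimpleGraph V}
    (hH : IsCoBipartite H) (hGH : G ≤ H) : ∃ s : V → Bool, fiberCompletion G s ≤ H := by
  classical
  obtain ⟨t, h1, h2⟩ := hH
  refine ⟨fun v => decide (v ∈ t), fun u v h => ?_⟩
  obtain ⟨huv, h | h⟩ := h
  · exact hGH h
  · have h : u ∈ t ↔ v ∈ t := by simpa using h
    by_cases hu : u ∈ t
    · exact h1 hu (h.1 hu) huv
    · exact h2 hu (fun hv => hu (h.2 hv)) huv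

/-- The number of fill edges of a co-bipartite completion. -/
noncomputable def fill {V : Type*} (G H : SimpleGraph V) : ℕ :=
  (H.edgeSet \ G.edgeSet).ncard

theorem IsMinCoBipCompletion.exists_eq_fiberCompletion {V : Type*} [Fintype V]
    {G H : SimpleGraph V} (h : IsMinCoBipCompletion G H) :
    ∃ s : V → Bool, H = fiberCompletion G s := by
  obtain ⟨hGH, hH, hmin⟩ := h
  obtain ⟨s, hs⟩ := hH.exists_fiberCompletion_le hGH
  refine ⟨s, le_antisymm ?_ hs⟩
  have hsub : (fiberCompletion G s).edgeSet \ G.edgeSet ⊆ H.edgeSet \ G.edgeSet :=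
    Set.sdiff_subset_sdiff_left (SimpleGraph.edgeSet_subset_edgeSet.2 hs)
  have heq := Set.eq_of_subset_of_ncard_le hsub
    (hmin _ (le_fiberCompletion G s) (isCoBipartite_fiberCompletion G s)) (Set.toFinite _)
  rw [← SimpleGraph.edgeSet_subset_edgeSet]
  intro e he
  by_cases heG : e ∈ G.edgeSet
  · exact SimpleGraph.edgeSet_subset_edgeSet.2 (le_fiberCompletion G s) heG
  · exact (heq.symm.subset ⟨he, heG⟩).1

theorem exists_isMinCoBipCompletion {V : Type*} [Fintype V] (G : SimpleGraph V) :
    ∃ H, IsMinCoBipCompletion G H := by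
  obtain ⟨H, ⟨h1, h2⟩, hmin⟩ := Set.exists_min_image {H | G ≤ H ∧ IsCoBipartite H} (fill G)
    (Set.toFinite _) ⟨_, le_fiberCompletion G fun _ => true, isCoBipartite_fiberCompletion G _⟩
  exact ⟨H, h1, h2, fun H' h1' h2' => hmin H' ⟨h1', h2'⟩⟩

theorem two_mul_fill_fiberCompletion {V : Type*} [Fintype V] [DecidableEq V]
    (G : SimpleGraph V) [DecidableRel G.Adj] (s : V → Bool) :
    2 * fill G (fiberCompletion G s) =
      ∑ u, ∑ v, if u ≠ v ∧ ¬ G.Adj u v then (if s u = s v then 1 else 0) else 0 := by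
  have hcard : 2 * (fiberCompletion G s \ G).edgeSet.ncard =
      ∑ u, (fiberCompletion G s \ G).degree u := by
    rw [SimpleGraph.sum_degrees_eq_twice_card_edges, Set.ncard_eq_toFinset_card',
      SimpleGraph.edgeFinset]
    congr!
  rw [fill, ← SimpleGraph.edgeSet_sdiff, hcard]
  refine Finset.sum_congr rfl fun u _ => ?_
  rw [← SimpleGraph.card_neighborFinset_eq_degree, SimpleGraph.neighborFinset_eq_filter,
    Finset.card_filter]
  refine Finset.sum_congr rfl fun v _ => ?_
  rw [← ite_and]
  congr 1
  simp only [SimpleGraph.sdiff_adj, fiberCompletion, eq_iff_iff]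
  tauto

/-- The disjoint union of `K₅` on `{0, …, 4}` and of two copies, on `{5, …, 9}` and
`{10, …, 14}`, of `K₄` with a pendant vertex: the first vertex of a copy is adjacent to the four
others, and its last vertex to no other. -/
def cliquesWithPendants : SimpleGraph (Fin 15) where
  Adj u v := u ≠ v ∧ u.val / 5 = v.val / 5 ∧
    (u.val < 5 ∨ (u.val % 5 ≠ 4 ∧ v.val % 5 ≠ 4) ∨ u.val % 5 = 0 ∨ v.val % 5 = 0)
  symm := ⟨fun u v h => by omega⟩
  loopless := ⟨fun _ h => h.1 rfl⟩

instance : DecidableRel cliquesWithPendants.Adj := fun u v =>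
  inferInstanceAs (Decidable (u ≠ v ∧ u.val / 5 = v.val / 5 ∧
    (u.val < 5 ∨ (u.val % 5 ≠ 4 ∧ v.val % 5 ≠ 4) ∨ u.val % 5 = 0 ∨ v.val % 5 = 0)))

theorem isQuasiThreshold_cliquesWithPendants : IsQuasiThreshold cliquesWithPendants := by
  have key : ∀ a b c d : Fin 15, a ≠ c → b ≠ d → cliquesWithPendants.Adj a b →
      cliquesWithPendants.Adj b c → cliquesWithPendants.Adj c d →
      ¬ cliquesWithPendants.Adj a c → cliquesWithPendants.Adj b d := by
    intro a b c d hac hbd hab hbc hcd hnac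
    simp only [cliquesWithPendants] at *
    refine ⟨hbd, ?_⟩
    omega
  constructor
  · rintro ⟨a, b, c, d, -, hac, -, -, hbd, -, h1, h2, h3, h4, -, h5⟩
    exact h5 (key a b c d hac hbd h1 h2 h3 h4)
  · rintro ⟨a, b, c, d, -, hac, -, -, hbd, -, h1, h2, h3, -, h4, h5⟩
    exact h5 (key a b c d hac hbd h1 h2 h3 h4)

theorem ite_eq_toNat (a b : Bool) :
    (if a = b then 1 else 0 : ℤ) =
      a.toNat * b.toNat + (1 - a.toNat) * (1 - b.toNat) := by
  cases a <;> cases b <;> rfl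

/-- The number of vertices of the block starting at `i` whose colour is `true`. -/
def blockCount (s : Fin 15 → Bool) (i : Fin 15) : ℤ :=
  (s i).toNat + (s (i + 1)).toNat + (s (i + 2)).toNat + (s (i + 3)).toNat + (s (i + 4)).toNat

/-- The number of fill edges inside the block starting at `i`, if it is a clique with pendant. -/
def blockFill (s : Fin 15 → Bool) (i : Fin 15) : ℤ :=
  (s (i + 4)).toNat * ((s (i + 1)).toNat + (s (i + 2)).toNat + (s (i + 3)).toNat) +
    (1 - (s (i + 4)).toNat) * (3 - (s (i + 1)).toNat - (s (i + 2)).toNat - (s (i + 3)).toNat)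

theorem fill_cliquesWithPendants (s : Fin 15 → Bool) :
    (fill cliquesWithPendants (fiberCompletion cliquesWithPendants s) : ℤ) =
      blockCount s 0 * blockCount s 5 + (5 - blockCount s 0) * (5 - blockCount s 5) +
      (blockCount s 0 * blockCount s 10 + (5 - blockCount s 0) * (5 - blockCount s 10)) +
      (blockCount s 5 * blockCount s 10 + (5 - blockCount s 5) * (5 - blockCount s 10)) +
      blockFill s 5 + blockFill s 10 := by
  have h := congrArg (Nat.cast : ℕ → ℤ) (two_mul_fill_fiberCompletion cliquesWithPendants s)
  have hrow : ∀ f : Fin 15 → ℤ, ∑ i, f i = f 0 + f 1 + f 2 + f 3 + f 4 + f 5 + f 6 + f 7 + f 8 +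
      f 9 + f 10 + f 11 + f 12 + f 13 + f 14 := fun f => by
    simp only [Fin.sum_univ_succ, Fin.sum_univ_zero]
    simp only [add_assoc, add_zero]
    rfl
  simp only [Nat.cast_mul, Nat.cast_sum, Nat.cast_ite, Nat.cast_one, Nat.cast_zero, ite_eq_toNat] at h
  simp only [hrow] at h
  simp +decide only [if_true, if_false] at h
  simp only [blockCount, blockFill, Fin.reduceAdd, zero_add]
  push_cast at h
  linarith

theorem blockCount_mem_Icc (s : Fin 15 → Bool) (i : Fin 15) :
    0 ≤ blockCount s i ∧ blockCount s i ≤ 5 := by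
  unfold blockCount
  have := fun j => Bool.toNat_le (s j)
  grind

theorem blockFill_spec (s : Fin 15 → Bool) (i : Fin 15) :
    0 ≤ blockFill s i ∧ (blockCount s i = 0 → blockFill s i = 3) ∧
      (blockCount s i = 5 → blockFill s i = 3) ∧
      (blockCount s i = 1 → blockFill s i = 0 → s i = false ∧ s (i + 4) = true) ∧
      (blockCount s i = 4 → blockFill s i = 0 → s i = true ∧ s (i + 4) = false) := by
  unfold blockCount blockFill
  generalize s i = a, s (i + 1) = b, s (i + 2) = c, s (i + 3) = d, s (i + 4) = e
  revert a b c d e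
  decide

theorem colours_of_fill_le (s : Fin 15 → Bool)
    (h : fill cliquesWithPendants (fiberCompletion cliquesWithPendants s) ≤ 27) :
    s 5 = s 10 ∧ s 9 = s 14 ∧ s 5 ≠ s 9 := by
  have h' : (fill cliquesWithPendants (fiberCompletion cliquesWithPendants s) : ℤ) ≤ 27 := by
    exact_mod_cast h
  rw [fill_cliquesWithPendants] at h'
  obtain ⟨hA, hA'⟩ := blockCount_mem_Icc s 0
  obtain ⟨hB, hB'⟩ := blockCount_mem_Icc s 5
  obtain ⟨hC, hC'⟩ := blockCount_mem_Icc s 10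
  obtain ⟨b0, b1, b2, b3, b4⟩ := blockFill_spec s 5
  obtain ⟨c0, c1, c2, c3, c4⟩ := blockFill_spec s 10
  simp only [Fin.reduceAdd] at b3 b4 c3 c4
  have key : blockFill s 5 = 0 ∧ blockFill s 10 = 0 ∧
      (blockCount s 5 = 1 ∧ blockCount s 10 = 1 ∨ blockCount s 5 = 4 ∧ blockCount s 10 = 4) := by
    clear b3 b4 c3 c4
    generalize blockFill s 5 = p, blockFill s 10 = q at *
    generalize blockCount s 0 = x, blockCount s 5 = y, blockCount s 10 = z at *
    interval_cases x <;> interval_cases y <;> interval_cases z <;> omega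
  grind

theorem exists_fill_le : ∃ s : Fin 15 → Bool,
    fill cliquesWithPendants (fiberCompletion cliquesWithPendants s) ≤ 27 := by
  refine ⟨fun v => decide (v.val < 5 ∨ v.val = 9 ∨ v.val = 14), ?_⟩
  zify
  rw [fill_cliquesWithPendants]
  decide

theorem IsMinCoBipCompletion.hasInducedC4 {H : SimpleGraph (Fin 15)}
    (h : IsMinCoBipCompletion cliquesWithPendants H) : HasInducedC4 H := by
  obtain ⟨t, ht⟩ := exists_fill_le
  obtain ⟨s, rfl⟩ := h.exists_eq_fiberCompletion
  obtain ⟨h1, h2, h3⟩ := colours_of_fill_le s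
    ((h.2.2 _ (le_fiberCompletion _ t) (isCoBipartite_fiberCompletion _ t)).trans ht)
  refine ⟨5, 10, 14, 9, by decide, by decide, by decide, by decide, by decide, by decide,
    ⟨by decide, .inr h1⟩, ⟨by decide, .inl (by decide)⟩, ⟨by decide, .inr h2.symm⟩,
    ⟨by decide, .inl (by decide)⟩, ?_, ?_⟩
  · rintro ⟨-, h | h⟩
    · exact absurd h (by decide)
    · exact h3 (h.trans h2.symm)
  · rintro ⟨-, h | h⟩
    · exact absurd h (by decide)
    · exact h3 (h1.trans h)

theorem exists_quasiThreshold_min_cobip_not_pig :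
    ∃ (n : ℕ) (G : SimpleGraph (Fin n)), IsQuasiThreshold G ∧
      (∀ H : SimpleGraph (Fin n), IsMinCoBipCompletion G H → ¬ IsProperIntervalGraph H) ∧
      ∃ H : SimpleGraph (Fin n), IsMinCoBipCompletion G H ∧ HasInducedC4 H := by
  obtain ⟨H, hH⟩ := exists_isMinCoBipCompletion cliquesWithPendants
  exact ⟨15, cliquesWithPendants, isQuasiThreshold_cliquesWithPendants,
    fun _ h => h.hasInducedC4.not_isProperIntervalGraph, H, hH, hH.hasInducedC4⟩
end

section
/- Let G be a caterpillar with central path v_0, ..., v_k, where vertex v_i has leaf-children set V_i. Then the minimum number of fill edges of a proper interval completion of G equals min over sequences (j_0, ..., j_k) with 0 ≤ j_i ≤ |V_i| of [ C(j_0, 2) + Σ_{i=1}^{k} C(|V_{i-1}| − j_{i-1} + j_i + 1, 2) + C(|V_k| − j_k, 2) ], where C(a,2) = a(a−1)/2. -/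
/-- The minimum number of fill edges of a proper interval completion of `G`. -/
noncomputable def pigCompletionNumber {V : Type*} [Fintype V] (G : SimpleGraph V) : ℕ :=
  sInf {m | ∃ H : SimpleGraph V, G ≤ H ∧ IsProperIntervalGraph H ∧ (H.edgeSet \ G.edgeSet).ncard = m}

/-- `G` is a caterpillar with central path `p 0, …, p k` and leaf-children sets
`Vset 0, …, Vset k` (the set `Vset i` consists of the leaves adjacent to `p i`). -/
def IsCaterpillar {V : Type*} (G : SimpleGraph V) (k : ℕ) (p : ℕ → V)
    (Vset : ℕ → Set V) : Prop :=
  (∀ i j, i ≤ k → j ≤ k → p i = p j → i = j) ∧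
  (∀ i j, i ≤ k → j ≤ k → p i ∉ Vset j) ∧
  (∀ i j, i ≤ k → j ≤ k → i ≠ j → Disjoint (Vset i) (Vset j)) ∧
  (∀ v : V, (∃ i, i ≤ k ∧ v = p i) ∨ (∃ i, i ≤ k ∧ v ∈ Vset i)) ∧
  (∀ u w : V, G.Adj u w ↔
    ((∃ i, i < k ∧ ((u = p i ∧ w = p (i + 1)) ∨ (w = p i ∧ u = p (i + 1)))) ∨
     (∃ i, i ≤ k ∧ ((u ∈ Vset i ∧ w = p i) ∨ (w ∈ Vset i ∧ u = p i)))))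

section ForwardDegree

variable {V : Type*} [Fintype V] [LinearOrder V]

open Classical in
/-- The neighbours of `w` in `H` that come after `w`. -/
noncomputable def forwardNeighbors (H : SimpleGraph V) (w : V) : Finset V :=
  Finset.univ.filter fun u => w < u ∧ H.Adj w u

/-- Every vertex between the two ends of an edge is adjacent to both ends. -/
def IsUmbrellaOrder (H : SimpleGraph V) : Prop :=
  (∀ u v w, u ≤ v → v < w → H.Adj u w → H.Adj v w) ∧
    ∀ u v w, u < v → v ≤ w → H.Adj u w → H.Adj u v

theorem card_filter_lt_card_Ioc_le (x : V) (t : ℕ) :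
    (Finset.univ.filter fun w : V =>
      w < x ∧ (Finset.univ.filter fun z => w < z ∧ z ≤ x).card ≤ t).card ≤ t := by
  set B := Finset.univ.filter fun w : V =>
      w < x ∧ (Finset.univ.filter fun z => w < z ∧ z ≤ x).card ≤ t with hB
  rcases B.eq_empty_or_nonempty with h | h
  · simp [h]
  set m := B.min' h with hm
  have hmB : m ∈ B := B.min'_mem h
  have hm2 := hmB
  rw [hB, Finset.mem_filter] at hm2
  obtain ⟨-, hmx, hmt⟩ := hm2
  have h1 : B ⊆ insert m (Finset.univ.filter fun z => m < z ∧ z < x) := by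
    intro w hw
    have h2 : m ≤ w := B.min'_le w hw
    rw [hB, Finset.mem_filter] at hw
    rcases h2.eq_or_lt with h3 | h3
    · simp [h3]
    · simp [h3, hw.2.1]
  have h2 : (Finset.univ.filter fun z => m < z ∧ z ≤ x) =
      insert x (Finset.univ.filter fun z => m < z ∧ z < x) := by
    ext z
    simp only [Finset.mem_filter, Finset.mem_univ, true_and, Finset.mem_insert]
    constructor
    · rintro ⟨a, b⟩
      rcases b.eq_or_lt with c | c
      · exact Or.inl c
      · exact Or.inr ⟨a, c⟩
    · rintro (rfl | ⟨a, b⟩)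
      · exact ⟨hmx, le_rfl⟩
      · exact ⟨a, b.le⟩
  rw [h2, Finset.card_insert_of_notMem (by simp)] at hmt
  exact ((Finset.card_le_card h1).trans (Finset.card_insert_le _ _)).trans hmt

theorem card_forwardNeighbors_le_between_le {H : SimpleGraph V} (hH : IsUmbrellaOrder H)
    (t : ℕ) {l r : V} (W : H.Walk l r) :
    (Finset.univ.filter fun w =>
      (forwardNeighbors H w).card ≤ t ∧ l ≤ w ∧ w < r).card ≤ t * W.length := by
  classical
  induction W with
  | nil =>
    rw [Finset.filter_false_of_mem]
    · simp
    · rintro w - ⟨-, a, b⟩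
      exact absurd b (not_lt.2 a)
  | @cons l x r hlx W ih =>
    have h1 : (Finset.univ.filter fun w =>
        (forwardNeighbors H w).card ≤ t ∧ l ≤ w ∧ w < r) ⊆
        (Finset.univ.filter fun w : V =>
          w < x ∧ (Finset.univ.filter fun z => w < z ∧ z ≤ x).card ≤ t) ∪
        (Finset.univ.filter fun w =>
          (forwardNeighbors H w).card ≤ t ∧ x ≤ w ∧ w < r) := by
      intro w hw
      simp only [Finset.mem_filter, Finset.mem_univ, true_and, Finset.mem_union] at hw ⊢
      obtain ⟨a, b, c⟩ := hw
      rcases lt_or_ge w x with d | d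
      · refine Or.inl ⟨d, le_trans (Finset.card_le_card ?_) a⟩
        intro z hz
        simp only [Finset.mem_filter, Finset.mem_univ, true_and, forwardNeighbors] at hz ⊢
        exact ⟨hz.1, hH.2 w z x hz.1 hz.2 (hH.1 l w x b d hlx)⟩
      · exact Or.inr ⟨a, d, c⟩
    refine (Finset.card_le_card h1).trans ((Finset.card_union_le _ _).trans ?_)
    have h2 := card_filter_lt_card_Ioc_le x t
    rw [SimpleGraph.Walk.length_cons, mul_add, mul_one]
    omega

theorem card_le_card_forwardNeighbors_gt {H : SimpleGraph V} (hH : IsUmbrellaOrder H)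
    (t m : ℕ) (S : Finset V) (hS : ∀ u ∈ S, ∀ v ∈ S, ∃ W : H.Walk u v, W.length ≤ m) :
    S.card ≤ (S.filter fun w => t < (forwardNeighbors H w).card).card + 1 + t * m := by
  classical
  rcases S.eq_empty_or_nonempty with h | h
  · simp [h]
  obtain ⟨W, hW⟩ := hS _ (S.min'_mem h) _ (S.max'_mem h)
  have h1 := card_forwardNeighbors_le_between_le hH t W
  have h2 := Nat.mul_le_mul_left t hW
  have h3 : (S.filter fun w => ¬ t < (forwardNeighbors H w).card) ⊆
      insert (S.max' h) (Finset.univ.filter fun w =>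
        (forwardNeighbors H w).card ≤ t ∧ S.min' h ≤ w ∧ w < S.max' h) := by
    intro w hw
    rw [Finset.mem_filter, not_lt] at hw
    rcases (S.le_max' w hw.1).eq_or_lt with e | e
    · simp [e.symm]
    · simp only [Finset.mem_insert, Finset.mem_filter, Finset.mem_univ, true_and]
      exact Or.inr ⟨hw.2, S.min'_le w hw.1, e⟩
  have h4 := (Finset.card_le_card h3).trans (Finset.card_insert_le _ _)
  have h5 := Finset.card_filter_add_card_filter_not (s := S)
    (fun w => t < (forwardNeighbors H w).card)
  omega

theorem sum_card_forwardNeighbors_le (H : SimpleGraph V) :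
    ∑ w, (forwardNeighbors H w).card ≤ H.edgeSet.ncard := by
  classical
  rw [← Finset.card_sigma, ← Set.ncard_coe_finset]
  refine Set.ncard_le_ncard_of_injOn (fun x => s(x.1, x.2)) ?_ ?_ (Set.toFinite _)
  · rintro ⟨w, u⟩ h
    simp only [forwardNeighbors, Finset.coe_sigma, Set.mem_sigma_iff, Finset.mem_coe,
      Finset.mem_filter, Finset.mem_univ, true_and] at h
    exact h.2
  · rintro ⟨w, u⟩ h ⟨w', u'⟩ h' e
    simp only [forwardNeighbors, Finset.coe_sigma, Set.mem_sigma_iff, Finset.mem_coe,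
      Finset.mem_filter, Finset.mem_univ, true_and] at h h'
    simp only [Sym2.eq_iff] at e
    rcases e with ⟨rfl, rfl⟩ | ⟨rfl, rfl⟩
    · rfl
    · exact absurd h.1 (not_lt.2 h'.1.le)

theorem sum_card_forwardNeighbors_gt_le (H : SimpleGraph V) (T : ℕ) :
    ∑ t ∈ Finset.range T,
      (Finset.univ.filter fun w => t < (forwardNeighbors H w).card).card ≤ H.edgeSet.ncard := by
  refine le_trans ?_ (sum_card_forwardNeighbors_le H)
  simp_rw [Finset.card_filter]
  rw [Finset.sum_comm]
  refine Finset.sum_le_sum fun w _ => ?_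
  rw [← Finset.card_filter]
  calc _ ≤ (Finset.range (forwardNeighbors H w).card).card := by
        refine Finset.card_le_card fun t ht => ?_
        simp only [Finset.mem_filter, Finset.mem_range] at ht ⊢
        exact ht.2
    _ = _ := Finset.card_range _

end ForwardDegree

theorem IsProperIntervalGraph.exists_isUmbrellaOrder {V : Type*} [Fintype V]
    {H : SimpleGraph V} (hH : IsProperIntervalGraph H) :
    ∃ _ : LinearOrder V, IsUmbrellaOrder H := by
  classical
  obtain ⟨a, b, hab, hadj, hprop⟩ := hH
  have mono : ∀ u v, a u ≤ a v → b u ≤ b v := by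
    intro u v h
    by_contra! h2
    exact h2.ne' (hprop u v h h2.le).2
  let e := Fintype.equivFin V
  let f : V → ℝ ×ₗ Fin (Fintype.card V) := fun v => toLex (a v, e v)
  have hf : Function.Injective f := by
    intro u v h
    have := congrArg (fun x => (ofLex x).2) h
    exact e.injective this
  let _ : LinearOrder V := LinearOrder.lift' f hf
  have ale : ∀ u v : V, u ≤ v → a u ≤ a v := by
    intro u v h
    have h' : f u ≤ f v := h
    rcases (Prod.Lex.le_iff).1 h' with h2 | h2
    · exact h2.le
    · exact h2.1.le
  refine ⟨inferInstance, fun u v w h1 h2 h3 => ?_, fun u v w h1 h2 h3 => ?_⟩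
  · rw [hadj] at h3 ⊢
    refine ⟨h2.ne, (ale _ _ h2.le).trans (hab w), h3.2.2.trans (mono _ _ (ale _ _ h1))⟩
  · rw [hadj] at h3 ⊢
    exact ⟨h1.ne, (ale _ _ h1.le).trans (hab v), (ale _ _ h2).trans h3.2.2⟩

section GroupSizes

/-- The number of edges along a Hamiltonian path of the clique at position `r`, when `n i` leaves
hang at the `i`-th spine vertex and `j i` of them are placed at position `i`. -/
def cliqueLength (n : ℕ → ℕ) (k : ℕ) (j : ℕ → ℕ) (r : ℕ) : ℕ :=
  (if r = 0 then 0 else n (r - 1) - j (r - 1)) + (if r ≤ k then j r else 0) +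
    (if 1 ≤ r ∧ r ≤ k then 1 else 0)

theorem sum_cliqueLength_choose_two (n : ℕ → ℕ) (k : ℕ) (j : ℕ → ℕ) :
    ∑ r ∈ Finset.range (k + 2), (cliqueLength n k j r).choose 2 =
      Nat.choose (j 0) 2 +
        (∑ i ∈ Finset.range k, Nat.choose (n i - j i + j (i + 1) + 1) 2) +
        Nat.choose (n k - j k) 2 := by
  rw [Finset.sum_range_succ, Finset.sum_range_succ']
  have h : ∀ i ∈ Finset.range k, (cliqueLength n k j (i + 1)).choose 2 =
      Nat.choose (n i - j i + j (i + 1) + 1) 2 := by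
    intro i hi
    have := Finset.mem_range.1 hi
    simp [cliqueLength, Nat.succ_le_of_lt this]
  rw [Finset.sum_congr rfl h]
  simp [cliqueLength]
  omega

theorem sum_Icc_cliqueLength (n : ℕ → ℕ) (k : ℕ) (j : ℕ → ℕ) (hj : ∀ i ≤ k, j i ≤ n i)
    (x y : ℕ) (hxy : x ≤ y) (hy : y ≤ k + 1) :
    ∑ r ∈ Finset.Icc x y, cliqueLength n k j r + 1 =
      ∑ i ∈ Finset.Ico x y, n i + (if x = 0 then 0 else n (x - 1) - j (x - 1)) +
        (if y ≤ k then j y else 0) + (min y k + 1 - (x - 1)) := by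
  induction y, hxy using Nat.le_induction with
  | base =>
    simp only [Finset.Icc_self, Finset.sum_singleton, Finset.Ico_self, Finset.sum_empty,
      cliqueLength]
    split_ifs <;> omega
  | succ y hxy ih =>
    rw [← Finset.insert_Icc_right_eq_Icc_add_one (by omega), Finset.sum_insert (by simp),
      Finset.sum_Ico_succ_top hxy]
    have := ih (by omega)
    have h3 := hj y (by omega)
    have h4 : cliqueLength n k j (y + 1) =
      n y - j y + (if y + 1 ≤ k then j (y + 1) else 0) + (if y + 1 ≤ k then 1 else 0) := by
      simp [cliqueLength]
    rw [h4]
    rw [if_pos (show y ≤ k by omega)] at this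
    split_ifs at * <;> omega

theorem sum_choose_two_exchange {s : Finset ℕ} {g g' : ℕ → ℕ} {p r : ℕ} (hp : p ∈ s) (hr : r ∈ s)
    (hpr : p ≠ r) (h : ∑ x ∈ s, (g x).choose 2 ≤ ∑ x ∈ s, (g' x).choose 2)
    (hoff : ∀ x, x ≠ p → x ≠ r → g' x = g x) (hr' : g' r = g r + 1) (hp' : g' p + 1 = g p) :
    g p ≤ g r + 1 := by
  have hr2 : r ∈ s.erase p := Finset.mem_erase.2 ⟨hpr.symm, hr⟩
  rw [← Finset.add_sum_erase _ _ hp, ← Finset.add_sum_erase _ _ hr2,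
    ← Finset.add_sum_erase s (fun x => (g' x).choose 2) hp,
    ← Finset.add_sum_erase (s.erase p) (fun x => (g' x).choose 2) hr2] at h
  have h2 : ∑ x ∈ (s.erase p).erase r, (g' x).choose 2 =
      ∑ x ∈ (s.erase p).erase r, (g x).choose 2 := by
    refine Finset.sum_congr rfl fun x hx => ?_
    simp only [Finset.mem_erase] at hx
    rw [hoff x hx.2.1 hx.1]
  rw [h2, hr', ← hp', Nat.choose_succ_succ' (g r) 1, Nat.choose_succ_succ' (g' p) 1] at h
  simp only [Nat.choose_one_right] at h
  simp only [Nat.reduceAdd] at h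
  omega

theorem exists_closed_superlevel (n : ℕ → ℕ) (k : ℕ) (j : ℕ → ℕ) (hj : ∀ i ≤ k, j i ≤ n i)
    (hopt : ∀ j' : ℕ → ℕ, (∀ i ≤ k, j' i ≤ n i) →
      ∑ r ∈ Finset.range (k + 2), (cliqueLength n k j r).choose 2 ≤
        ∑ r ∈ Finset.range (k + 2), (cliqueLength n k j' r).choose 2) (t : ℕ) :
    ∃ A : ℕ → Prop, (∀ r, A r → r ≤ k + 1 ∧ t ≤ cliqueLength n k j r) ∧
      (∀ r, r ≤ k + 1 → ¬ A r → cliqueLength n k j r ≤ t) ∧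
      (∀ y, y ≤ k → A y → ¬ A (y + 1) → j y = 0) ∧
      (∀ y, y ≤ k → A (y + 1) → ¬ A y → n y ≤ j y) := by
  refine ⟨fun r => r ≤ k + 1 ∧ (t < cliqueLength n k j r ∨
    (∃ p, r < p ∧ p ≤ k + 1 ∧ t < cliqueLength n k j p ∧ ∀ i, r ≤ i → i < p → j i < n i) ∨
    (∃ p, p < r ∧ t < cliqueLength n k j p ∧ ∀ i, p ≤ i → i < r → 0 < j i)), ?_, ?_, ?_, ?_⟩
  · rintro r ⟨hr, h | ⟨p, hrp, hp, hg, h⟩ | ⟨p, hrp, hg, h⟩⟩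
    · exact ⟨hr, h.le⟩
    · refine ⟨hr, ?_⟩
      have := sum_choose_two_exchange (s := Finset.range (k + 2)) (p := p) (r := r)
        (by simp; omega) (by simp; omega) (by omega)
        (hopt (fun i => j i + if r ≤ i ∧ i < p then 1 else 0) ?_) ?_ ?_ ?_
      · omega
      · intro i hi
        have := hj i hi
        have := h i
        split_ifs <;> omega
      · intro x hx1 hx2
        have h1 := h x
        have h2 := h (x - 1)
        simp only [cliqueLength]
        split_ifs <;> omega
      · have h1 := h r
        have h2 := h (r - 1)
        simp only [cliqueLength]
        split_ifs <;> omega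
      · have h1 := h p
        have h2 := h (p - 1)
        simp only [cliqueLength]
        split_ifs <;> omega
    · refine ⟨hr, ?_⟩
      have := sum_choose_two_exchange (s := Finset.range (k + 2)) (p := p) (r := r)
        (by simp; omega) (by simp; omega) (by omega)
        (hopt (fun i => j i - if p ≤ i ∧ i < r then 1 else 0) ?_) ?_ ?_ ?_
      · omega
      · intro i hi
        have := hj i hi
        have := h i
        split_ifs <;> omega
      · intro x hx1 hx2
        have h1 := h x
        have h2 := h (x - 1)
        have h3 := hj (x - 1)
        simp only [cliqueLength]
        split_ifs <;> omega
      · have h1 := h r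
        have h2 := h (r - 1)
        have h3 := hj (r - 1)
        simp only [cliqueLength]
        split_ifs <;> omega
      · have h1 := h p
        have h2 := h (p - 1)
        simp only [cliqueLength]
        split_ifs <;> omega
  · intro r hr h
    by_contra! h2
    exact h ⟨hr, Or.inl h2⟩
  · rintro y hy ⟨-, h⟩ h2
    by_contra h3
    apply h2
    refine ⟨by omega, ?_⟩
    rcases h with h | ⟨p, hrp, hp, hg, h⟩ | ⟨p, hrp, hg, h⟩
    · exact Or.inr (Or.inr ⟨y, by omega, h, fun i _ _ => by
        obtain rfl : i = y := by omega
        omega⟩)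
    · rcases (show y + 1 ≤ p from hrp).eq_or_lt with rfl | h4
      · exact Or.inl hg
      · exact Or.inr (Or.inl ⟨p, h4, hp, hg, fun i _ _ => h i (by omega) (by omega)⟩)
    · refine Or.inr (Or.inr ⟨p, by omega, hg, fun i h4 h5 => ?_⟩)
      rcases (show i ≤ y by omega).eq_or_lt with rfl | h6
      · omega
      · exact h i h4 h6
  · rintro y hy ⟨-, h⟩ h2
    by_contra! h3
    apply h2
    refine ⟨by omega, ?_⟩
    rcases h with h | ⟨p, hrp, hp, hg, h⟩ | ⟨p, hrp, hg, h⟩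
    · exact Or.inr (Or.inl ⟨y + 1, by omega, by omega, h, fun i _ _ => by
        obtain rfl : i = y := by omega
        omega⟩)
    · refine Or.inr (Or.inl ⟨p, by omega, hp, hg, fun i h4 h5 => ?_⟩)
      rcases h4.eq_or_lt with rfl | h6
      · omega
      · exact h i h6 h5
    · rcases (show p ≤ y by omega).eq_or_lt with rfl | h4
      · exact Or.inl hg
      · exact Or.inr (Or.inr ⟨p, h4, hg, fun i _ _ => h i (by omega) (by omega)⟩)

theorem sum_range_sub_eq_choose_two (x T : ℕ) (h : x ≤ T) :
    ∑ t ∈ Finset.range T, (x - t) = (x + 1).choose 2 := by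
  induction x generalizing T with
  | zero => simp
  | succ x ih =>
    obtain ⟨T, rfl⟩ : ∃ T', T = T' + 1 := ⟨T - 1, by omega⟩
    rw [Finset.sum_range_succ', Nat.choose_succ_succ' (x + 1) 1, Nat.choose_one_right,
      ← ih T (by omega)]
    simp [add_comm]

end GroupSizes

namespace IsCaterpillar

variable {V : Type*} {G : SimpleGraph V} {k : ℕ} {p : ℕ → V} {Vset : ℕ → Set V}

/-- `idx` sends the `i`-th spine vertex and all its leaf-children to `i`. -/
def IsIndex (k : ℕ) (p : ℕ → V) (Vset : ℕ → Set V) (idx : V → ℕ) : Prop :=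
  (∀ v, idx v ≤ k) ∧ (∀ v, v = p (idx v) ∨ v ∈ Vset (idx v)) ∧
    (∀ i ≤ k, idx (p i) = i) ∧ ∀ i ≤ k, ∀ v ∈ Vset i, idx v = i

theorem exists_isIndex (hcat : IsCaterpillar G k p Vset) :
    ∃ idx : V → ℕ, IsIndex k p Vset idx := by
  obtain ⟨hinj, hnot, hdisj, hcov, -⟩ := hcat
  have h : ∀ v, ∃ i, i ≤ k ∧ (v = p i ∨ v ∈ Vset i) := by
    intro v
    rcases hcov v with ⟨i, hi, h⟩ | ⟨i, hi, h⟩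
    · exact ⟨i, hi, Or.inl h⟩
    · exact ⟨i, hi, Or.inr h⟩
  choose idx hle hidx using h
  refine ⟨idx, hle, hidx, fun i hi => ?_, fun i hi v hv => ?_⟩
  · rcases hidx (p i) with h | h
    · exact (hinj _ _ hi (hle _) h).symm
    · exact absurd h (hnot _ _ hi (hle _))
  · rcases hidx v with h | h
    · exact absurd (h ▸ hv) (hnot _ _ (hle v) hi)
    · by_contra hne
      exact Set.disjoint_left.1 (hdisj _ _ (hle v) hi hne) h hv

theorem exists_spine_walk (hcat : IsCaterpillar G k p Vset) {i j : ℕ} (hij : i ≤ j)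
    (hj : j ≤ k) : ∃ W : G.Walk (p i) (p j), W.length = j - i := by
  induction j, hij using Nat.le_induction with
  | base => exact ⟨SimpleGraph.Walk.nil, by simp⟩
  | succ j hij ih =>
    obtain ⟨W, hW⟩ := ih (by omega)
    have h : G.Adj (p j) (p (j + 1)) :=
      (hcat.2.2.2.2 _ _).2 (Or.inl ⟨j, by omega, Or.inl ⟨rfl, rfl⟩⟩)
    exact ⟨W.concat h, by rw [SimpleGraph.Walk.length_concat]; omega⟩

theorem exists_walk_le (hcat : IsCaterpillar G k p Vset) {idx : V → ℕ}
    (hidx : IsIndex k p Vset idx) (u v : V) :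
    ∃ W : G.Walk u v, (W.length ≤ (idx u - idx v) + (idx v - idx u) + 2) ∧
      (u = p (idx u) → W.length ≤ (idx u - idx v) + (idx v - idx u) + 1) ∧
      (v = p (idx v) → W.length ≤ (idx u - idx v) + (idx v - idx u) + 1) ∧
      (u = p (idx u) → v = p (idx v) → W.length ≤ (idx u - idx v) + (idx v - idx u)) := by
  have h1 : ∀ u, ∃ W : G.Walk u (p (idx u)), W.length ≤ 1 ∧ (u = p (idx u) → W.length = 0) := by
    intro u
    rcases hidx.2.1 u with h | h
    · exact ⟨SimpleGraph.Walk.nil.copy rfl h, by simp, by simp⟩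
    · have hadj : G.Adj u (p (idx u)) :=
        (hcat.2.2.2.2 _ _).2 (Or.inr ⟨idx u, hidx.1 u, Or.inl ⟨h, rfl⟩⟩)
      exact ⟨hadj.toWalk, by simp, fun h2 => absurd h2 hadj.ne⟩
  have h2 : ∃ W : G.Walk (p (idx u)) (p (idx v)),
      W.length = (idx u - idx v) + (idx v - idx u) := by
    rcases le_total (idx u) (idx v) with h | h
    · obtain ⟨W, hW⟩ := hcat.exists_spine_walk h (hidx.1 v)
      exact ⟨W, by omega⟩
    · obtain ⟨W, hW⟩ := hcat.exists_spine_walk h (hidx.1 u)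
      exact ⟨W.reverse, by rw [SimpleGraph.Walk.length_reverse]; omega⟩
  obtain ⟨Wu, hu, hu0⟩ := h1 u
  obtain ⟨Wv, hv, hv0⟩ := h1 v
  obtain ⟨W, hW⟩ := h2
  refine ⟨(Wu.append W).append Wv.reverse, ?_⟩
  simp only [SimpleGraph.Walk.length_append, SimpleGraph.Walk.length_reverse]
  refine ⟨by omega, fun h => ?_, fun h => ?_, fun h h' => ?_⟩
  · have := hu0 h
    omega
  · have := hv0 h
    omega
  · have := hu0 h
    have := hv0 h'
    omega

variable [Fintype V]

open Classical in
/-- The part of the caterpillar that meets only the positions `x, …, y`, with the spine vertices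
at its boundary: the leaves with index in `[x, y)` and the spine vertices with index in `[x - 1, y]`. -/
noncomputable def segment (p : ℕ → V) (Vset : ℕ → Set V) (idx : V → ℕ) (x y : ℕ) : Finset V :=
  Finset.univ.filter fun v => (v ∈ Vset (idx v) ∧ x ≤ idx v ∧ idx v < y) ∨
    (v = p (idx v) ∧ x ≤ idx v + 1 ∧ idx v ≤ y)

theorem card_segment (hcat : IsCaterpillar G k p Vset) {idx : V → ℕ}
    (hidx : IsIndex k p Vset idx) {x y : ℕ} (hy : y ≤ k + 1) :
    (segment p Vset idx x y).card =
      ∑ i ∈ Finset.Ico x y, (Vset i).ncard + (min y k + 1 - (x - 1)) := by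
  classical
  have h1 : segment p Vset idx x y = (Finset.Ico x y).biUnion (fun i => (Vset i).toFinset) ∪
      (Finset.Icc (x - 1) (min y k)).image p := by
    ext v
    simp only [segment, Finset.mem_filter, Finset.mem_univ, true_and, Finset.mem_union,
      Finset.mem_biUnion, Finset.mem_Ico, Set.mem_toFinset, Finset.mem_image, Finset.mem_Icc]
    constructor
    · rintro (⟨a, b, c⟩ | ⟨a, b, c⟩)
      · exact Or.inl ⟨_, ⟨b, c⟩, a⟩
      · have := hidx.1 v
        exact Or.inr ⟨_, ⟨by omega, by omega⟩, a.symm⟩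
    · rintro (⟨i, ⟨a, b⟩, c⟩ | ⟨i, ⟨a, b⟩, rfl⟩)
      · have := hidx.2.2.2 i (by omega) v c
        exact Or.inl ⟨by rwa [this], by omega, by omega⟩
      · have := hidx.2.2.1 i (by omega)
        exact Or.inr ⟨by rw [this], by omega, by omega⟩
  rw [h1, Finset.card_union_of_disjoint, Finset.card_biUnion, Finset.card_image_of_injOn,
    Nat.card_Icc]
  · simp only [Set.ncard_eq_toFinset_card']
  · intro i hi i' hi' h
    simp only [Finset.coe_Icc, Set.mem_Icc] at hi hi'
    exact hcat.1 _ _ (by omega) (by omega) h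
  · intro i hi i' hi' hne
    rw [Finset.mem_coe, Finset.mem_Ico] at hi hi'
    simpa [Function.onFun] using hcat.2.2.1 i i' (by omega) (by omega) hne
  · rw [Finset.disjoint_left]
    simp only [Finset.mem_biUnion, Finset.mem_Ico, Set.mem_toFinset, Finset.mem_image,
      Finset.mem_Icc, not_exists, not_and]
    rintro v ⟨i, hi, hv⟩ i' hi' rfl
    exact hcat.2.1 i' i (by omega) (by omega) hv

theorem card_vert (hcat : IsCaterpillar G k p Vset) (j : ℕ → ℕ)
    (hj : ∀ i ≤ k, j i ≤ (Vset i).ncard) :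
    Fintype.card V =
      ∑ r ∈ Finset.range (k + 2), cliqueLength (fun i => (Vset i).ncard) k j r + 1 := by
  classical
  obtain ⟨idx, hidx⟩ := hcat.exists_isIndex
  have h1 := sum_Icc_cliqueLength (fun i => (Vset i).ncard) k j hj 0 (k + 1) (by omega) le_rfl
  have h2 := hcat.card_segment hidx (x := 0) (y := k + 1) le_rfl
  have h3 : segment p Vset idx 0 (k + 1) = Finset.univ := by
    ext v
    simp only [segment, Finset.mem_filter, Finset.mem_univ, true_and, iff_true]
    have := hidx.1 v
    rcases hidx.2.1 v with h | h
    · exact Or.inr ⟨h, by omega, by omega⟩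
    · exact Or.inl ⟨h, by omega, by omega⟩
  rw [h3, Finset.card_univ] at h2
  have h4 : Finset.range (k + 2) = Finset.Icc 0 (k + 1) := by
    ext i
    simp only [Finset.mem_range, Finset.mem_Icc]
    omega
  rw [h2, h4, h1]
  simp

theorem card_vert_le_ncard_edgeSet_add_one (hcat : IsCaterpillar G k p Vset) :
    Fintype.card V ≤ G.edgeSet.ncard + 1 := by
  obtain ⟨idx, hidx⟩ := hcat.exists_isIndex
  have : Nonempty V := ⟨p 0⟩
  have hconn : G.Connected := by
    refine ⟨fun u v => ?_⟩
    obtain ⟨W, -⟩ := hcat.exists_walk_le hidx u v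
    exact ⟨W⟩
  have := hconn.card_vert_le_card_edgeSet_add_one
  rwa [Nat.card_eq_fintype_card, Nat.card_coe_set_eq] at this

theorem ncard_edgeSet_add_one_le_card_vert (hcat : IsCaterpillar G k p Vset) :
    G.edgeSet.ncard + 1 ≤ Fintype.card V := by
  classical
  obtain ⟨idx, hidx⟩ := hcat.exists_isIndex
  let f : V → Sym2 V := fun v =>
    if v = p (idx v) then s(p (idx v - 1), v) else s(v, p (idx v))
  have h1 : G.edgeSet ⊆ f '' {v | v ≠ p 0} := by
    intro e
    induction e using Sym2.ind with
    | _ u w =>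
    rw [SimpleGraph.mem_edgeSet, hcat.2.2.2.2]
    have spine : ∀ i, i < k → f (p (i + 1)) = s(p i, p (i + 1)) ∧ p (i + 1) ≠ p 0 := by
      intro i hi
      have h := hidx.2.2.1 (i + 1) (by omega)
      refine ⟨by simp [f, h], fun h' => ?_⟩
      have := hcat.1 _ _ (by omega) (by omega) h'
      omega
    have leaf : ∀ i, i ≤ k → ∀ v ∈ Vset i, f v = s(v, p i) ∧ v ≠ p 0 := by
      intro i hi v hv
      have h := hidx.2.2.2 i hi v hv
      have hne : ∀ i' ≤ k, v ≠ p i' := by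
        rintro i' hi' rfl
        exact hcat.2.1 _ _ hi' hi hv
      exact ⟨by simp [f, h, hne i hi], hne 0 (by omega)⟩
    rintro (⟨i, hi, ⟨rfl, rfl⟩ | ⟨rfl, rfl⟩⟩ | ⟨i, hi, ⟨h, rfl⟩ | ⟨h, rfl⟩⟩)
    · exact ⟨_, (spine i hi).2, (spine i hi).1⟩
    · exact ⟨_, (spine i hi).2, (spine i hi).1.trans Sym2.eq_swap⟩
    · exact ⟨_, (leaf i hi _ h).2, (leaf i hi _ h).1⟩
    · exact ⟨_, (leaf i hi _ h).2, (leaf i hi _ h).1.trans Sym2.eq_swap⟩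
  have h2 := (Set.ncard_le_ncard h1 (Set.toFinite _)).trans (Set.ncard_image_le (Set.toFinite _))
  have h3 : {v | v ≠ p 0} = ((Finset.univ.erase (p 0) : Finset V) : Set V) := by
    ext v
    simp
  rw [h3, Set.ncard_coe_finset, Finset.card_erase_of_mem (Finset.mem_univ _),
    Finset.card_univ] at h2
  have : 0 < Fintype.card V := Fintype.card_pos_iff.2 ⟨p 0⟩
  omega

section LowerBound

variable [LinearOrder V] {H : SimpleGraph V}

theorem sum_Icc_cliqueLength_le (hcat : IsCaterpillar G k p Vset) {idx : V → ℕ}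
    (hidx : IsIndex k p Vset idx) (hGH : G ≤ H) (hH : IsUmbrellaOrder H) (j : ℕ → ℕ)
    (hj : ∀ i ≤ k, j i ≤ (Vset i).ncard) (t : ℕ) {x y : ℕ} (hxy : x ≤ y) (hy : y ≤ k + 1)
    (hx0 : x ≠ 0 → (Vset (x - 1)).ncard ≤ j (x - 1)) (hy0 : y ≤ k → j y = 0) :
    ∑ r ∈ Finset.Icc x y, cliqueLength (fun i => (Vset i).ncard) k j r ≤
      (Finset.univ.filter fun w =>
        x ≤ idx w + 1 ∧ idx w ≤ y ∧ t < (forwardNeighbors H w).card).card + t * (y + 1 - x) := by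
  have h1 := sum_Icc_cliqueLength (fun i => (Vset i).ncard) k j hj x y hxy hy
  have h2 := hcat.card_segment hidx (x := x) hy
  have h3 : (if x = 0 then 0 else (Vset (x - 1)).ncard - j (x - 1)) = 0 := by
    split_ifs with h
    · rfl
    · exact Nat.sub_eq_zero_of_le (hx0 h)
  have h4 : (if y ≤ k then j y else 0) = 0 := by
    split_ifs with h
    · exact hy0 h
    · rfl
  have h5 := card_le_card_forwardNeighbors_gt hH t (y + 1 - x) (segment p Vset idx x y) (by
    intro u hu v hv
    obtain ⟨W, w1, w2, w3, w4⟩ := hcat.exists_walk_le hidx u v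
    refine ⟨W.mapLe hGH, ?_⟩
    rw [SimpleGraph.Walk.mapLe, SimpleGraph.Walk.length_map]
    simp only [segment, Finset.mem_filter, Finset.mem_univ, true_and] at hu hv
    rcases hu with ⟨-, hu1, hu2⟩ | ⟨hu, hu1, hu2⟩ <;> rcases hv with ⟨-, hv1, hv2⟩ | ⟨hv, hv1, hv2⟩
    · omega
    · have := w3 hv
      omega
    · have := w2 hu
      omega
    · have := w4 hu hv
      omega)
  have h6 : ((segment p Vset idx x y).filter fun w => t < (forwardNeighbors H w).card).card ≤
      (Finset.univ.filter fun w =>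
        x ≤ idx w + 1 ∧ idx w ≤ y ∧ t < (forwardNeighbors H w).card).card := by
    refine Finset.card_le_card fun w hw => ?_
    simp only [segment, Finset.mem_filter, Finset.mem_univ, true_and] at hw ⊢
    omega
  rw [h3, h4] at h1
  omega

theorem sum_cliqueLength_sub_le (hcat : IsCaterpillar G k p Vset) (hGH : G ≤ H)
    (hH : IsUmbrellaOrder H) (j : ℕ → ℕ) (hj : ∀ i ≤ k, j i ≤ (Vset i).ncard)
    (hopt : ∀ j' : ℕ → ℕ, (∀ i ≤ k, j' i ≤ (Vset i).ncard) →
      ∑ r ∈ Finset.range (k + 2), (cliqueLength (fun i => (Vset i).ncard) k j r).choose 2 ≤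
        ∑ r ∈ Finset.range (k + 2), (cliqueLength (fun i => (Vset i).ncard) k j' r).choose 2)
    (t : ℕ) :
    ∑ r ∈ Finset.range (k + 2), (cliqueLength (fun i => (Vset i).ncard) k j r - t) ≤
      (Finset.univ.filter fun w => t < (forwardNeighbors H w).card).card := by
  classical
  obtain ⟨idx, hidx⟩ := hcat.exists_isIndex
  obtain ⟨A, hA1, hA2, hA3, hA4⟩ :=
    exists_closed_superlevel (fun i => (Vset i).ncard) k j hj hopt t
  set g := cliqueLength (fun i => (Vset i).ncard) k j with hg
  have key : ∀ x, x ≤ k + 2 → ¬ A x → ∑ r ∈ Finset.range x, (g r - t) ≤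
      (Finset.univ.filter fun w => idx w < x ∧ t < (forwardNeighbors H w).card).card := by
    intro x
    induction x using Nat.strong_induction_on with
    | _ x ih =>
    intro hx hAx
    rcases x with _ | y
    · simp
    by_cases hAy : A y
    · have hex : ∃ z, z ≤ y ∧ ∀ r, z ≤ r → r ≤ y → A r :=
        ⟨y, le_rfl, fun r h1 h2 => by rwa [le_antisymm h2 h1]⟩
      set z := Nat.find hex with hz
      obtain ⟨hzy, hzA⟩ := Nat.find_spec hex
      have hmin : ∀ m, m < z → ¬ (m ≤ y ∧ ∀ r, m ≤ r → r ≤ y → A r) :=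
        fun m hm => Nat.find_min hex hm
      rw [← hz] at hzy hzA
      have hbefore : z ≠ 0 → ¬ A (z - 1) := by
        intro h0 hA
        refine hmin (z - 1) (by omega) ⟨by omega, fun r h1 h2 => ?_⟩
        rcases h1.eq_or_lt with rfl | h3
        · exact hA
        · exact hzA r (by omega) h2
      have hI := hcat.sum_Icc_cliqueLength_le hidx hGH hH j hj t hzy (by omega)
        (fun h0 => hA4 (z - 1) (by omega)
          (by rw [Nat.sub_add_cancel (by omega)]; exact hzA z le_rfl hzy) (hbefore h0))
        (fun hy => hA3 y hy hAy hAx)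
      rw [← hg] at hI
      have hsum : ∑ r ∈ Finset.Icc z y, g r =
          ∑ r ∈ Finset.Icc z y, (g r - t) + t * (y + 1 - z) := by
        have : ∀ r ∈ Finset.Icc z y, g r = (g r - t) + t := by
          intro r hr
          rw [Finset.mem_Icc] at hr
          have := (hA1 r (hzA r hr.1 hr.2)).2
          omega
        rw [Finset.sum_congr rfl this, Finset.sum_add_distrib, Finset.sum_const, Nat.card_Icc,
          smul_eq_mul, mul_comm]
      have hsplit : ∑ r ∈ Finset.range (y + 1), (g r - t) =
          ∑ r ∈ Finset.range z, (g r - t) + ∑ r ∈ Finset.Icc z y, (g r - t) := by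
        rw [← Finset.sum_range_add_sum_Ico _ (show z ≤ y + 1 by omega)]
        rfl
      have hprev : ∑ r ∈ Finset.range z, (g r - t) ≤
          (Finset.univ.filter fun w =>
            idx w + 1 < z ∧ t < (forwardNeighbors H w).card).card := by
        rcases Nat.eq_zero_or_pos z with h0 | h0
        · simp [h0]
        · obtain ⟨z', hz'⟩ : ∃ z', z = z' + 1 := ⟨z - 1, by omega⟩
          have hn := hbefore (by omega)
          rw [hz', Nat.add_sub_cancel] at hn
          have h1 := ih z' (by omega) (by omega) hn
          have h2 := hA2 z' (by omega) hn
          rw [hz', Finset.sum_range_succ, Nat.sub_eq_zero_of_le h2, add_zero]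
          simpa using h1
      have hunion : (Finset.univ.filter fun w =>
            idx w + 1 < z ∧ t < (forwardNeighbors H w).card).card +
          (Finset.univ.filter fun w =>
            z ≤ idx w + 1 ∧ idx w ≤ y ∧ t < (forwardNeighbors H w).card).card ≤
          (Finset.univ.filter fun w =>
            idx w < y + 1 ∧ t < (forwardNeighbors H w).card).card := by
        rw [← Finset.card_union_of_disjoint]
        · refine Finset.card_le_card fun w hw => ?_
          simp only [Finset.mem_union, Finset.mem_filter, Finset.mem_univ, true_and] at hw ⊢
          omega
        · rw [Finset.disjoint_left]
          intro w hw
          simp only [Finset.mem_filter, Finset.mem_univ, true_and] at hw ⊢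
          omega
      omega
    · have h1 := ih y (by omega) (by omega) hAy
      have h2 := hA2 y (by omega) hAy
      rw [Finset.sum_range_succ, Nat.sub_eq_zero_of_le h2, add_zero]
      refine h1.trans (Finset.card_le_card fun w hw => ?_)
      simp only [Finset.mem_filter, Finset.mem_univ, true_and] at hw ⊢
      omega
  refine (key (k + 2) le_rfl fun h => ?_).trans (Finset.card_le_card fun w hw => ?_)
  · have := (hA1 _ h).1
    omega
  · simp only [Finset.mem_filter, Finset.mem_univ, true_and] at hw ⊢
    exact hw.2

end LowerBound

theorem sum_choose_two_eq (hcat : IsCaterpillar G k p Vset) (j : ℕ → ℕ)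
    (hj : ∀ i ≤ k, j i ≤ (Vset i).ncard) :
    ∑ r ∈ Finset.range (k + 2), (cliqueLength (fun i => (Vset i).ncard) k j r + 1).choose 2 =
      ∑ r ∈ Finset.range (k + 2), (cliqueLength (fun i => (Vset i).ncard) k j r).choose 2 +
        G.edgeSet.ncard := by
  have h1 := hcat.card_vert j hj
  have h2 := hcat.card_vert_le_ncard_edgeSet_add_one
  have h3 := hcat.ncard_edgeSet_add_one_le_card_vert
  have h4 : ∀ x : ℕ, (x + 1).choose 2 = x + x.choose 2 := fun x => by
    rw [Nat.choose_succ_succ' x 1, Nat.choose_one_right]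
  simp_rw [h4]
  rw [Finset.sum_add_distrib]
  omega

theorem le_ncard_fill (hcat : IsCaterpillar G k p Vset) {H : SimpleGraph V} (hGH : G ≤ H)
    (hH : IsProperIntervalGraph H) (j : ℕ → ℕ) (hj : ∀ i ≤ k, j i ≤ (Vset i).ncard)
    (hopt : ∀ j' : ℕ → ℕ, (∀ i ≤ k, j' i ≤ (Vset i).ncard) →
      ∑ r ∈ Finset.range (k + 2), (cliqueLength (fun i => (Vset i).ncard) k j r).choose 2 ≤
        ∑ r ∈ Finset.range (k + 2), (cliqueLength (fun i => (Vset i).ncard) k j' r).choose 2) :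
    ∑ r ∈ Finset.range (k + 2), (cliqueLength (fun i => (Vset i).ncard) k j r).choose 2 ≤
      (H.edgeSet \ G.edgeSet).ncard := by
  obtain ⟨_, hU⟩ := hH.exists_isUmbrellaOrder
  have h1 := hcat.sum_choose_two_eq j hj
  have h2 := Set.ncard_sdiff_add_ncard_of_subset (SimpleGraph.edgeSet_mono hGH) (Set.toFinite _)
  set T := ∑ r ∈ Finset.range (k + 2), cliqueLength (fun i => (Vset i).ncard) k j r with hT
  have h3 := sum_card_forwardNeighbors_gt_le H T
  have h4 : ∑ r ∈ Finset.range (k + 2),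
      (cliqueLength (fun i => (Vset i).ncard) k j r + 1).choose 2 = ∑ t ∈ Finset.range T,
        ∑ r ∈ Finset.range (k + 2), (cliqueLength (fun i => (Vset i).ncard) k j r - t) := by
    rw [Finset.sum_comm]
    refine Finset.sum_congr rfl fun r hr => (sum_range_sub_eq_choose_two _ _ ?_).symm
    exact Finset.single_le_sum (f := cliqueLength (fun i => (Vset i).ncard) k j)
      (fun _ _ => Nat.zero_le _) hr
  have h5 := Finset.sum_le_sum fun t (_ : t ∈ Finset.range T) =>
    hcat.sum_cliqueLength_sub_le hGH hU j hj hopt t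
  omega

theorem exists_completion (hcat : IsCaterpillar G k p Vset) (j : ℕ → ℕ)
    (hj : ∀ i ≤ k, j i ≤ (Vset i).ncard) :
    ∃ H : SimpleGraph V, G ≤ H ∧ IsProperIntervalGraph H ∧ (H.edgeSet \ G.edgeSet).ncard ≤
      ∑ r ∈ Finset.range (k + 2),
        (cliqueLength (fun i => (Vset i).ncard) k j r).choose 2 := by
  classical
  obtain ⟨idx, hidx⟩ := hcat.exists_isIndex
  have hL : ∀ i, ∃ L ⊆ Vset i, i ≤ k → L.ncard = j i := by
    intro i
    by_cases hi : i ≤ k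
    · obtain ⟨L, h1, h2⟩ := Set.exists_subset_card_eq (hj i hi)
      exact ⟨L, h1, fun _ => h2⟩
    · exact ⟨∅, Set.empty_subset _, fun h => absurd h hi⟩
  choose L hLsub hLcard using hL
  let pos : V → ℕ := fun v => if v ∈ L (idx v) then idx v else idx v + 1
  let a : V → ℤ := fun v => if v = p (idx v) then 5 * idx v else 5 * pos v - 2
  let b : V → ℤ := fun v => if v = p (idx v) then 5 * idx v + 5 else 5 * pos v + 2
  let H : SimpleGraph V :=
    { Adj := fun u v => u ≠ v ∧ a u ≤ b v ∧ a v ≤ b u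
      symm := ⟨fun u v h => ⟨h.1.symm, h.2.2, h.2.1⟩⟩
      loopless := ⟨fun u h => h.1 rfl⟩ }
  have hpos : ∀ v, pos v = idx v ∨ pos v = idx v + 1 := by
    intro v
    by_cases h : v ∈ L (idx v)
    · exact Or.inl (if_pos h)
    · exact Or.inr (if_neg h)
  have hspine : ∀ i ≤ k, a (p i) = 5 * i ∧ b (p i) = 5 * i + 5 := by
    intro i hi
    have h := hidx.2.2.1 i hi
    simp [a, b, h]
  have hGH : G ≤ H := by
    intro u v huv
    refine ⟨huv.ne, ?_⟩
    have leaf : ∀ i ≤ k, ∀ v ∈ Vset i, 5 * (i : ℤ) - 2 ≤ a v ∧ a v ≤ 5 * i + 3 ∧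
        5 * (i : ℤ) + 2 ≤ b v := by
      intro i hi v hv
      have h := hidx.2.2.2 i hi v hv
      have h1 := hpos v
      have h2 : v ≠ p (idx v) := by
        intro h3
        rw [h3] at hv
        exact hcat.2.1 _ _ (hidx.1 v) hi hv
      simp only [a, b, if_neg h2]
      omega
    rcases (hcat.2.2.2.2 u v).1 huv with
      ⟨i, hi, ⟨rfl, rfl⟩ | ⟨rfl, rfl⟩⟩ | ⟨i, hi, ⟨h, rfl⟩ | ⟨h, rfl⟩⟩
    · have h1 := hspine i (by omega)
      have h2 := hspine (i + 1) (by omega)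
      push_cast at h2
      omega
    · have h1 := hspine i (by omega)
      have h2 := hspine (i + 1) (by omega)
      push_cast at h2
      omega
    · have h1 := hspine i hi
      have h2 := leaf i hi _ h
      omega
    · have h1 := hspine i hi
      have h2 := leaf i hi _ h
      omega
  refine ⟨H, hGH, ⟨fun v => a v, fun v => b v, fun v => ?_, fun u v => ?_, fun u v h1 h2 => ?_⟩, ?_⟩
  · have : a v ≤ b v := by
      simp only [a, b]
      split_ifs <;> omega
    exact Int.cast_le.2 this
  · simp only [H, Int.cast_le]
  · rw [Int.cast_le] at h1 h2
    rw [Int.cast_inj, Int.cast_inj]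
    simp only [a, b] at h1 h2 ⊢
    split_ifs at * <;> omega
  · let K : ℕ → Finset V := fun r => Finset.univ.filter fun v =>
      (v ≠ p (idx v) ∧ pos v = r) ∨ (v = p (idx v) ∧ (r = idx v ∨ r = idx v + 1))
    have hcover : H.edgeSet ⊆ ((Finset.range (k + 2)).biUnion fun r =>
        (K r).offDiag.image Sym2.mk.uncurry : Finset (Sym2 V)) := by
      intro e
      induction e using Sym2.ind with
      | _ u v =>
      rintro ⟨hne, h1, h2⟩
      have hu := hidx.1 u
      have hv := hidx.1 v
      have hpu := hpos u
      have hpv := hpos v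
      have hr : ∃ r, r < k + 2 ∧ u ∈ K r ∧ v ∈ K r := by
        simp only [K, Finset.mem_filter, Finset.mem_univ, true_and]
        simp only [a, b] at h1 h2
        by_cases cu : u = p (idx u) <;> by_cases cv : v = p (idx v)
        · rw [if_pos cu, if_pos cv] at h1 h2
          exact ⟨max (idx u) (idx v), by omega, Or.inr ⟨cu, by omega⟩, Or.inr ⟨cv, by omega⟩⟩
        · rw [if_pos cu, if_neg cv] at h1 h2
          exact ⟨pos v, by omega, Or.inr ⟨cu, by omega⟩, Or.inl ⟨cv, rfl⟩⟩
        · rw [if_neg cu, if_pos cv] at h1 h2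
          exact ⟨pos u, by omega, Or.inl ⟨cu, rfl⟩, Or.inr ⟨cv, by omega⟩⟩
        · rw [if_neg cu, if_neg cv] at h1 h2
          exact ⟨pos u, by omega, Or.inl ⟨cu, rfl⟩, Or.inl ⟨cv, by omega⟩⟩
      obtain ⟨r, hr, hur, hvr⟩ := hr
      simp only [Finset.coe_biUnion, Set.mem_iUnion, Finset.coe_image, Set.mem_image,
        Finset.mem_coe, Finset.mem_range]
      exact ⟨r, hr, (u, v), Finset.mem_offDiag.2 ⟨hur, hvr, hne⟩, rfl⟩
    have hK : ∀ r ∈ Finset.range (k + 2),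
        (K r).card ≤ cliqueLength (fun i => (Vset i).ncard) k j r + 1 := by
      intro r hr
      rw [Finset.mem_range] at hr
      have hsub : K r ⊆ ((if r = 0 then ∅ else (Vset (r - 1) \ L (r - 1)).toFinset) ∪
          (if r ≤ k then (L r).toFinset else ∅)) ∪ (Finset.Icc (r - 1) (min r k)).image p := by
        intro v hv
        simp only [K, Finset.mem_filter, Finset.mem_univ, true_and] at hv
        rw [Finset.mem_union, Finset.mem_union]
        have hvk := hidx.1 v
        rcases hv with ⟨hv, hr'⟩ | ⟨hv, hr'⟩
        · left
          have hv2 := (hidx.2.1 v).resolve_left hv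
          by_cases hvL : v ∈ L (idx v)
          · have h1 : pos v = idx v := if_pos hvL
            obtain rfl : r = idx v := by omega
            right
            simp [hvk, hvL]
          · have h1 : pos v = idx v + 1 := if_neg hvL
            obtain rfl : r = idx v + 1 := by omega
            left
            simp [hv2, hvL]
        · right
          exact Finset.mem_image.2 ⟨idx v, Finset.mem_Icc.2 (by omega), hv.symm⟩
      have h1 := (Finset.card_le_card hsub).trans ((Finset.card_union_le _ _).trans
        (Nat.add_le_add (Finset.card_union_le _ _) Finset.card_image_le))
      have h2 : (if r = 0 then ∅ else (Vset (r - 1) \ L (r - 1)).toFinset).card =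
          if r = 0 then 0 else (Vset (r - 1)).ncard - j (r - 1) := by
        split_ifs with h
        · rfl
        · rw [← Set.ncard_eq_toFinset_card', Set.ncard_sdiff (hLsub _) (Set.toFinite _),
            hLcard _ (by omega)]
      have h3 : (if r ≤ k then (L r).toFinset else ∅).card = if r ≤ k then j r else 0 := by
        split_ifs with h
        · rw [← Set.ncard_eq_toFinset_card', hLcard _ h]
        · rfl
      rw [h2, h3, Nat.card_Icc] at h1
      refine h1.trans ?_
      simp only [cliqueLength]
      split_ifs <;> omega
    have h1 := Set.ncard_le_ncard hcover (Finset.finite_toSet _)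
    rw [Set.ncard_coe_finset] at h1
    have h2 : ((Finset.range (k + 2)).biUnion fun r =>
        (K r).offDiag.image Sym2.mk.uncurry).card ≤ ∑ r ∈ Finset.range (k + 2),
          (cliqueLength (fun i => (Vset i).ncard) k j r + 1).choose 2 := by
      refine Finset.card_biUnion_le.trans (Finset.sum_le_sum fun r hr => ?_)
      rw [Sym2.card_image_offDiag]
      exact Nat.choose_le_choose 2 (hK r hr)
    have h3 := hcat.sum_choose_two_eq j hj
    have h4 := Set.ncard_sdiff_add_ncard_of_subset (SimpleGraph.edgeSet_mono hGH) (Set.toFinite _)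
    omega

end IsCaterpillar

theorem caterpillar_pig_completion_formula {V : Type*} [Fintype V]
    (G : SimpleGraph V) (k : ℕ) (p : ℕ → V) (Vset : ℕ → Set V)
    (hcat : IsCaterpillar G k p Vset) :
    pigCompletionNumber G =
      sInf {m | ∃ j : ℕ → ℕ, (∀ i, i ≤ k → j i ≤ (Vset i).ncard) ∧
        m = Nat.choose (j 0) 2 +
            (∑ i ∈ Finset.range k,
              Nat.choose ((Vset i).ncard - j i + j (i + 1) + 1) 2) +
            Nat.choose ((Vset k).ncard - j k) 2} := by
  set M := {m | ∃ j : ℕ → ℕ, (∀ i, i ≤ k → j i ≤ (Vset i).ncard) ∧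
        m = Nat.choose (j 0) 2 +
            (∑ i ∈ Finset.range k,
              Nat.choose ((Vset i).ncard - j i + j (i + 1) + 1) 2) +
            Nat.choose ((Vset k).ncard - j k) 2} with hM
  have hMne : M.Nonempty := ⟨_, fun _ => 0, fun _ _ => Nat.zero_le _, rfl⟩
  obtain ⟨j, hj, hjM⟩ := Nat.sInf_mem hMne
  rw [← sum_cliqueLength_choose_two (fun i => (Vset i).ncard) k j] at hjM
  have hopt : ∀ j' : ℕ → ℕ, (∀ i ≤ k, j' i ≤ (Vset i).ncard) →
      ∑ r ∈ Finset.range (k + 2), (cliqueLength (fun i => (Vset i).ncard) k j r).choose 2 ≤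
        ∑ r ∈ Finset.range (k + 2),
          (cliqueLength (fun i => (Vset i).ncard) k j' r).choose 2 := by
    intro j' hj'
    rw [← hjM]
    exact Nat.sInf_le ⟨j', hj', sum_cliqueLength_choose_two (fun i => (Vset i).ncard) k j'⟩
  obtain ⟨H, hGH, hH, hcard⟩ := hcat.exists_completion j hj
  have hmem : (H.edgeSet \ G.edgeSet).ncard ∈ {m | ∃ H : SimpleGraph V, G ≤ H ∧
      IsProperIntervalGraph H ∧ (H.edgeSet \ G.edgeSet).ncard = m} := ⟨H, hGH, hH, rfl⟩
  rw [hjM]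
  refine le_antisymm ((Nat.sInf_le hmem).trans hcard) ?_
  obtain ⟨H', hGH', hH', h⟩ := Nat.sInf_mem ⟨_, hmem⟩
  rw [pigCompletionNumber, ← h]
  exact hcat.le_ncard_fill hGH' hH' j hj hopt
end

section
/- Every caterpillar admits a minimum proper interval completion H together with a representation in which each central-path vertex v_i is represented by the unit interval [i, i+1] and each leaf-child of v_i is represented by a degenerate point at i or at i+1 (after rescaling, a proper interval representation of H exists with these intersection patterns). -/
namespace CaterpillarCompletion

theorem succ_choose_two (m : ℕ) : (m + 1).choose 2 = m + m.choose 2 := by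
  rw [Nat.choose_succ_succ' m 1, Nat.choose_one_right]

theorem choose_two_le_sum_tsub (d M : ℕ) (h : d ≤ M) :
    (d + 1).choose 2 ≤ ∑ i ∈ Finset.range M, (d - i) := by
  induction d generalizing M with
  | zero => simp
  | succ d ih =>
    obtain ⟨M, rfl⟩ : ∃ M', M = M' + 1 := ⟨M - 1, by omega⟩
    rw [Finset.sum_range_succ', succ_choose_two]
    have := ih M (by omega)
    simp only [Nat.add_sub_add_right, Nat.sub_zero]
    omega

/-- The gap after position `g` separates the positions of `u` and `w`. -/
def Crosses {V : Type*} (pos : V → ℕ) (u w : V) (g : ℕ) : Prop :=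
  min (pos u) (pos w) ≤ g ∧ g < max (pos u) (pos w)

/-- A rooted forest laid out on a line crosses at least as many gaps as it has edges. -/
theorem card_le_card_crossed {V : Type*} [Fintype V] (pos : V → ℕ) (x : ℕ → V)
    (hx : ∀ j < Fintype.card V, pos (x j) = j) (D : Finset V) (par : V → V) (rank : V → ℕ)
    (hrank : ∀ v ∈ D, rank (par v) < rank v) :
    D.card ≤ Set.ncard {g | g < Fintype.card V ∧ ∃ v ∈ D, Crosses pos v (par v) g} := by
  classical
  set N := Fintype.card V with hN
  have hset : {g | g < N ∧ ∃ v ∈ D, Crosses pos v (par v) g} =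
      ((Finset.range N).filter fun g => ∃ v ∈ D, Crosses pos v (par v) g : Finset ℕ) := by
    ext; simp
  rw [hset, Set.ncard_coe_finset]
  have hsum := Finset.card_filter_add_card_filter_not (s := Finset.range N)
    (fun g => ∃ v ∈ D, Crosses pos v (par v) g)
  rw [Finset.card_range] at hsum
  have hD := Finset.card_add_card_compl D
  suffices h : ((Finset.range N).filter fun g => ¬ ∃ v ∈ D, Crosses pos v (par v) g).card
      ≤ Dᶜ.card by omega
  set W := (Finset.range N).filter fun g => ¬ ∃ v ∈ D, Crosses pos v (par v) g with hW
  have key : ∀ e ∈ W, ∃ v, v ∉ D ∧ pos v ≤ e ∧ ∀ g ∈ W, ¬ (pos v ≤ g ∧ g < e) := by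
    intro e he
    have heN : e < N := by simp [hW] at he; exact he.1
    let S : Finset V := Finset.univ.filter fun v => pos v ≤ e ∧ ∀ g ∈ W, ¬ (pos v ≤ g ∧ g < e)
    have hS : S.Nonempty := ⟨x e, by
      simp only [S, Finset.mem_filter, Finset.mem_univ, true_and, hx e heN]
      exact ⟨le_rfl, fun g _ => by omega⟩⟩
    obtain ⟨v, hvS, hvmin⟩ := S.exists_min_image rank hS
    have hv := (Finset.mem_filter.1 hvS).2
    refine ⟨v, fun hvD => ?_, hv⟩
    have hnc : ∀ g ∈ W, ¬ Crosses pos v (par v) g := fun g hg hc =>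
      (Finset.mem_filter.1 hg).2 ⟨v, hvD, hc⟩
    have hp : par v ∈ S := by
      simp only [S, Finset.mem_filter, Finset.mem_univ, true_and]
      have h1 : pos (par v) ≤ e := by
        by_contra hlt
        exact hnc e he ⟨by omega, by omega⟩
      refine ⟨h1, fun g hg hgg => ?_⟩
      have := hv.2 g hg
      exact hnc g hg ⟨by omega, by omega⟩
    exact absurd (hvmin _ hp) (by have := hrank v hvD; omega)
  have : Nonempty V := ⟨x 0⟩
  choose! f hf using key
  refine Finset.card_le_card_of_injOn f (fun e he => by
    simpa using (hf e he).1) ?_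
  intro e he e' he' hee
  have h1 := hf e he
  have h2 := hf e' he'
  rw [hee] at h1
  rcases lt_trichotomy e e' with h | h | h
  · exact absurd ⟨h1.2.1, h⟩ (h2.2.2 e he)
  · exact h
  · exact absurd ⟨h2.2.1, h⟩ (h1.2.2 e' he')

/-- Proper interval graphs admit umbrella orderings. -/
theorem exists_umbrella_ordering {V : Type*} [Fintype V] [Nonempty V] {H : SimpleGraph V}
    {a b : V → ℝ} (hadj : ∀ u v, H.Adj u v ↔ u ≠ v ∧ a u ≤ b v ∧ a v ≤ b u)
    (hprop : ∀ u v, a u ≤ a v → b v ≤ b u → a u = a v ∧ b u = b v) :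
    ∃ (pos : V → ℕ) (x : ℕ → V), (∀ v, pos v < Fintype.card V) ∧ (∀ v, x (pos v) = v) ∧
      (∀ j < Fintype.card V, pos (x j) = j) ∧
      ∀ u w i j, H.Adj u w → pos u ≤ i → i < j → j ≤ pos w → H.Adj (x i) (x j) := by
  classical
  let e₀ := Fintype.equivFin V
  let e : Fin (Fintype.card V) ≃ V := (Tuple.sort (a ∘ e₀.symm)).trans e₀.symm
  have hmono : Monotone (a ∘ e) := Tuple.monotone_sort (a ∘ e₀.symm)
  have hbm : ∀ u v, a u ≤ a v → b u ≤ b v := by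
    intro u v huv
    by_contra hlt
    have := hprop u v huv (by linarith)
    linarith [this.2]
  let x : ℕ → V := fun j => if h : j < Fintype.card V then e ⟨j, h⟩ else Classical.arbitrary V
  have hxpos : ∀ v, x (e.symm v : ℕ) = v := by intro v; simp [x]
  have hposx : ∀ j < Fintype.card V, ((e.symm (x j) : Fin _) : ℕ) = j := by
    intro j hj; simp [x, hj]
  refine ⟨fun v => e.symm v, x, fun v => (e.symm v).2, hxpos, hposx, ?_⟩
  intro u w i j huw hi hij hj
  have hjN : j < Fintype.card V := lt_of_le_of_lt hj (e.symm w).2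
  have hiN : i < Fintype.card V := hij.trans hjN
  have hle : ∀ s t : V, ((e.symm s : Fin _) : ℕ) ≤ e.symm t → a s ≤ a t := by
    intro s t hst
    have := hmono (show e.symm s ≤ e.symm t from hst)
    simpa using this
  have h1 : a u ≤ a (x i) := hle _ _ (by rw [hposx i hiN]; exact hi)
  have h2 : a (x i) ≤ a (x j) := hle _ _ (by rw [hposx i hiN, hposx j hjN]; exact hij.le)
  have h3 : a (x j) ≤ a w := hle _ _ (by rw [hposx j hjN]; exact hj)
  have h4 := (hadj u w).1 huw
  have h5 := hbm _ _ h1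
  have h6 := hbm _ _ h2
  have h7 := hbm _ _ h3
  have hne : x i ≠ x j := by
    intro h
    have := hposx i hiN
    rw [h, hposx j hjN] at this
    omega
  have h8 : a (x j) ≤ b (x i) := by linarith [h4.2.2]
  exact (hadj _ _).2 ⟨hne, by linarith, h8⟩

theorem sum_card_le_ncard_edgeSet {V : Type*} [Fintype V] (H : SimpleGraph V) (pos : V → ℕ)
    (x : ℕ → V) (hx : ∀ j < Fintype.card V, pos (x j) = j) (M : ℕ) :
    ∑ h ∈ Finset.range M,
      Set.ncard {j | j + h + 1 < Fintype.card V ∧ H.Adj (x j) (x (j + h + 1))}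
      ≤ H.edgeSet.ncard := by
  classical
  set N := Fintype.card V with hN
  have hset : ∀ h, {j | j + h + 1 < N ∧ H.Adj (x j) (x (j + h + 1))} =
      ((Finset.range N).filter fun j => j + h + 1 < N ∧ H.Adj (x j) (x (j + h + 1)) :
        Finset ℕ) := by
    intro h; ext j
    simp only [Set.mem_ofPred_eq, Finset.coe_filter, Finset.mem_range]
    constructor
    · rintro ⟨h1, h2⟩; exact ⟨by omega, h1, h2⟩
    · exact fun h => h.2
  simp only [hset, Set.ncard_coe_finset]
  rw [← Finset.card_sigma, ← SimpleGraph.coe_edgeFinset, Set.ncard_coe_finset]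
  refine Finset.card_le_card_of_injOn (fun q => s(x q.2, x (q.2 + q.1 + 1))) ?_ ?_
  · rintro ⟨h, j⟩ hq
    simp only [Finset.coe_sigma, Set.mem_sigma_iff, Finset.mem_coe, Finset.mem_filter] at hq
    simpa using hq.2.2.2
  · rintro ⟨h, j⟩ hq ⟨h', j'⟩ hq' heq
    simp only [Finset.coe_sigma, Set.mem_sigma_iff, Finset.mem_coe, Finset.mem_filter,
      Finset.mem_range] at hq hq'
    have p1 := hx j (by omega)
    have p2 := hx (j + h + 1) (by omega)
    have p3 := hx j' (by omega)
    have p4 := hx (j' + h' + 1) (by omega)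
    simp only [Sym2.eq_iff] at heq
    rcases heq with ⟨e1, e2⟩ | ⟨e1, e2⟩
    · rw [e1, p3] at p1
      rw [e2, p4] at p2
      obtain rfl := p1
      obtain rfl : h = h' := by omega
      rfl
    · rw [e1, p4] at p1
      rw [e2, p3] at p2
      omega

theorem exists_crosses_of_chain {V : Type*} (pos : V → ℕ) (z : ℕ → V) {a b g : ℕ}
    (hab : a ≤ b) (hg : Crosses pos (z a) (z b) g) :
    ∃ c, a ≤ c ∧ c < b ∧ Crosses pos (z c) (z (c + 1)) g := by
  induction b, hab using Nat.le_induction with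
  | base => exact absurd hg (by unfold Crosses; omega)
  | succ b hab ih =>
    by_cases h : Crosses pos (z a) (z b) g
    · obtain ⟨c, h1, h2, h3⟩ := ih h
      exact ⟨c, h1, by omega, h3⟩
    · refine ⟨b, hab, by omega, ?_⟩
      unfold Crosses at *
      omega

/-- The number of gaps between consecutive path vertices when `l i` of the `n i` leaf-children
of the `i`-th path vertex are placed to its left. -/
def step (k : ℕ) (n l : ℕ → ℕ) : ℕ → ℕ
  | 0 => l 0
  | c + 1 => (if c + 1 ≤ k then 1 else 0) + (n c - l c) + l (c + 1)

def energy (k : ℕ) (n l : ℕ → ℕ) : ℕ :=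
  ∑ c ∈ Finset.range (k + 2), (step k n l c + 1).choose 2

theorem exists_energy_min (k : ℕ) (n : ℕ → ℕ) :
    ∃ l : ℕ → ℕ, (∀ i, l i ≤ n i) ∧
      ∀ l' : ℕ → ℕ, (∀ i, l' i ≤ n i) → energy k n l ≤ energy k n l' := by
  classical
  have h : ∃ m, ∃ l : ℕ → ℕ, (∀ i, l i ≤ n i) ∧ energy k n l = m :=
    ⟨_, n, fun _ => le_rfl, rfl⟩
  obtain ⟨l, hl, he⟩ := Nat.find_spec h
  exact ⟨l, hl, fun l' hl' => he ▸ Nat.find_min' h ⟨l', hl', rfl⟩⟩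

theorem step_le_of_transfer {k : ℕ} {n l l' : ℕ → ℕ} {a c : ℕ}
    (hle : energy k n l ≤ energy k n l') (ha : a < k + 2) (hc : c < k + 2) (hac : a ≠ c)
    (h1 : step k n l' a + 1 = step k n l a) (h2 : step k n l' c = step k n l c + 1)
    (h3 : ∀ j, j ≠ a → j ≠ c → step k n l' j = step k n l j) :
    step k n l a ≤ step k n l c + 1 := by
  unfold energy at hle
  have hcm : c ∈ (Finset.range (k + 2)).erase a :=
    Finset.mem_erase.2 ⟨hac.symm, Finset.mem_range.2 hc⟩
  rw [← Finset.add_sum_erase _ _ (Finset.mem_range.2 ha), ← Finset.add_sum_erase _ _ hcm,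
    ← Finset.add_sum_erase _ (fun c => (step k n l' c + 1).choose 2) (Finset.mem_range.2 ha),
    ← Finset.add_sum_erase _ (fun c => (step k n l' c + 1).choose 2) hcm] at hle
  have hrest : ∑ j ∈ ((Finset.range (k + 2)).erase a).erase c, (step k n l' j + 1).choose 2 =
      ∑ j ∈ ((Finset.range (k + 2)).erase a).erase c, (step k n l j + 1).choose 2 := by
    refine Finset.sum_congr rfl fun j hj => ?_
    simp only [Finset.mem_erase] at hj
    rw [h3 j hj.2.1 hj.1]
  rw [hrest, ← h1, h2, succ_choose_two (step k n l' a + 1),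
    succ_choose_two (step k n l c + 1)] at hle
  omega

theorem step_le_of_forall_pos {k : ℕ} {n l : ℕ → ℕ} (hl : ∀ i, l i ≤ n i)
    (hmin : ∀ l' : ℕ → ℕ, (∀ i, l' i ≤ n i) → energy k n l ≤ energy k n l') {a c : ℕ}
    (hac : a ≤ c) (hc : c < k + 2) (hpos : ∀ i, a ≤ i → i < c → 0 < l i) :
    step k n l a ≤ step k n l c + 1 := by
  rcases hac.eq_or_lt with rfl | hac
  · omega
  refine step_le_of_transfer (l' := fun i => if a ≤ i ∧ i < c then l i - 1 else l i)
    (hmin _ fun i => ?_) (by omega) hc hac.ne ?_ ?_ ?_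
  · have := hl i
    split_ifs <;> omega
  · have h1 := hpos a le_rfl hac
    cases a with
    | zero => simp only [step]; split_ifs <;> omega
    | succ a => have := hl a; simp only [step]; split_ifs <;> omega
  · obtain ⟨c, rfl⟩ : ∃ c', c = c' + 1 := ⟨c - 1, by omega⟩
    have h1 := hpos c (by omega) (by omega)
    have := hl c
    simp only [step]; split_ifs <;> omega
  · intro j hja hjc
    cases j with
    | zero => simp only [step]; split_ifs <;> omega
    | succ j =>
      have := hl j
      have h1 := hpos j
      have h2 := hpos (j + 1)
      simp only [step]; split_ifs <;> omega

theorem step_le_of_forall_lt {k : ℕ} {n l : ℕ → ℕ} (hl : ∀ i, l i ≤ n i)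
    (hmin : ∀ l' : ℕ → ℕ, (∀ i, l' i ≤ n i) → energy k n l ≤ energy k n l') {a c : ℕ}
    (hca : c ≤ a) (ha : a < k + 2) (hlt : ∀ i, c ≤ i → i < a → l i < n i) :
    step k n l a ≤ step k n l c + 1 := by
  rcases hca.eq_or_lt with rfl | hca
  · omega
  refine step_le_of_transfer (l' := fun i => if c ≤ i ∧ i < a then l i + 1 else l i)
    (hmin _ fun i => ?_) ha (by omega) hca.ne' ?_ ?_ ?_
  · have := hl i
    have := hlt i
    split_ifs <;> omega
  · obtain ⟨a, rfl⟩ : ∃ a', a = a' + 1 := ⟨a - 1, by omega⟩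
    have h1 := hlt a (by omega) (by omega)
    have := hl a
    simp only [step]; split_ifs <;> omega
  · have h1 := hlt c le_rfl hca
    cases c with
    | zero => simp only [step]; split_ifs <;> omega
    | succ c => have := hl c; simp only [step]; split_ifs <;> omega
  · intro j hja hjc
    cases j with
    | zero => simp only [step]; split_ifs <;> omega
    | succ j =>
      have := hl j
      have h1 := hlt j
      have h2 := hlt (j + 1)
      simp only [step]; split_ifs <;> omega

/-- For every threshold `h`, the steps longer than `h` of an energy-minimal layout extend to a
set `Y` of steps of length at least `h` whose maximal runs are tight at both ends. -/
theorem exists_tight_steps {k : ℕ} {n l : ℕ → ℕ} (hl : ∀ i, l i ≤ n i)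
    (hn : ∀ i, k < i → n i = 0)
    (hmin : ∀ l' : ℕ → ℕ, (∀ i, l' i ≤ n i) → energy k n l ≤ energy k n l') (h : ℕ) :
    ∃ Y ⊆ Finset.range (k + 2), (∀ c < k + 2, h < step k n l c → c ∈ Y) ∧
      (∀ c ∈ Y, h ≤ step k n l c) ∧ (∀ c, c ∈ Y → c + 1 ∉ Y → l c = 0) ∧
      (∀ c, c ∉ Y → c + 1 ∈ Y → l c = n c) := by
  classical
  refine ⟨(Finset.range (k + 2)).filter fun c => ∃ a < k + 2, h < step k n l a ∧
    ((a ≤ c ∧ ∀ i, a ≤ i → i < c → 0 < l i) ∨ (c ≤ a ∧ ∀ i, c ≤ i → i < a → l i < n i)),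
    Finset.filter_subset _ _, ?_, ?_, ?_, ?_⟩
  · intro c hc hh
    simp only [Finset.mem_filter, Finset.mem_range]
    exact ⟨hc, c, hc, hh, Or.inl ⟨le_rfl, fun i _ _ => by omega⟩⟩
  · intro c hc
    simp only [Finset.mem_filter, Finset.mem_range] at hc
    obtain ⟨hc, a, ha, hh, ⟨hac, hp⟩ | ⟨hca, hp⟩⟩ := hc
    · have := step_le_of_forall_pos hl hmin hac hc hp
      omega
    · have := step_le_of_forall_lt hl hmin hca ha hp
      omega
  · intro c hc hc'
    simp only [Finset.mem_filter, Finset.mem_range] at hc hc'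
    obtain ⟨hc, a, ha, hh, hr⟩ := hc
    by_contra h0
    have hck : c ≤ k := by
      by_contra hck
      have := hn c (by omega)
      have := hl c
      omega
    refine hc' ⟨by omega, a, ha, hh, ?_⟩
    rcases hr with ⟨hac, hp⟩ | ⟨hca, hp⟩
    · refine Or.inl ⟨by omega, fun i h1 h2 => ?_⟩
      rcases (Nat.lt_succ_iff.1 h2).eq_or_lt with rfl | h2
      · omega
      · exact hp i h1 h2
    · rcases hca.eq_or_lt with rfl | hca
      · refine Or.inl ⟨by omega, fun i h1 h2 => ?_⟩
        obtain rfl : i = c := by omega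
        omega
      · exact Or.inr ⟨hca, fun i h1 h2 => hp i (by omega) h2⟩
  · intro c hc' hc
    simp only [Finset.mem_filter, Finset.mem_range] at hc hc'
    obtain ⟨hc, a, ha, hh, hr⟩ := hc
    by_contra h0
    have h0 : l c < n c := lt_of_le_of_ne (hl c) h0
    refine hc' ⟨by omega, a, ha, hh, ?_⟩
    rcases hr with ⟨hac, hp⟩ | ⟨hca, hp⟩
    · rcases hac.eq_or_lt with rfl | hac
      · refine Or.inr ⟨by omega, fun i h1 h2 => ?_⟩
        obtain rfl : i = c := by omega
        omega
      · exact Or.inl ⟨by omega, fun i h1 h2 => hp i h1 (by omega)⟩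
    · refine Or.inr ⟨by omega, fun i h1 h2 => ?_⟩
      rcases h1.eq_or_lt with rfl | h1
      · omega
      · exact hp i h1 h2

theorem sum_step_le {k : ℕ} {n l : ℕ → ℕ} (hl : ∀ i, l i ≤ n i)
    (hn : ∀ i, k < i → n i = 0) {Y : Finset ℕ} (hY : Y ⊆ Finset.range (k + 2))
    (h0 : ∀ c, c ∈ Y → c + 1 ∉ Y → l c = 0) (h1 : ∀ c, c ∉ Y → c + 1 ∈ Y → l c = n c) :
    ∑ c ∈ Y, step k n l c ≤ (Y.filter fun c => 1 ≤ c ∧ c ≤ k).card +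
      ∑ i ∈ (Finset.range (k + 1)).filter (fun i => i ∈ Y ∧ i + 1 ∈ Y), n i := by
  classical
  have hY' : Y = (Finset.range (k + 2)).filter (· ∈ Y) := by
    ext c; simp only [Finset.mem_filter]; exact ⟨fun h => ⟨hY h, h⟩, fun h => h.2⟩
  have hlk : l (k + 1) = 0 := by have := hl (k + 1); have := hn (k + 1) (by omega); omega
  have e1 : ∑ c ∈ Y, step k n l c =
      ∑ c ∈ Y, (if 1 ≤ c ∧ c ≤ k then 1 else 0) + ∑ c ∈ Y, (if c = 0 then 0 else
        n (c - 1) - l (c - 1)) + ∑ c ∈ Y, l c := by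
    rw [← Finset.sum_add_distrib, ← Finset.sum_add_distrib]
    refine Finset.sum_congr rfl fun c _ => ?_
    cases c with
    | zero => simp [step]
    | succ c => simp [step]
  have e2 : ∑ c ∈ Y, l c = ∑ i ∈ Finset.range (k + 1), if i ∈ Y then l i else 0 := by
    conv_lhs => rw [hY']
    rw [Finset.sum_filter, Finset.sum_range_succ, hlk]
    simp
  have e3 : ∑ c ∈ Y, (if c = 0 then 0 else n (c - 1) - l (c - 1)) =
      ∑ i ∈ Finset.range (k + 1), if i + 1 ∈ Y then n i - l i else 0 := by
    conv_lhs => rw [hY']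
    rw [Finset.sum_filter, Finset.sum_range_succ']
    simp
  rw [e1, e2, e3, add_assoc, ← Finset.sum_add_distrib, Finset.card_filter, Finset.sum_filter]
  gcongr with i
  have := h0 i
  have := h1 i
  have := hl i
  by_cases hi : i ∈ Y <;> by_cases hi' : i + 1 ∈ Y <;>
    simp only [hi, hi', not_true_eq_false, not_false_eq_true, true_imp_iff, false_imp_iff,
      if_true, if_false, and_self, and_true, and_false] at * <;> omega

/-- The number of leaf-children of the `i`-th path vertex, zero beyond the end of the path. -/
noncomputable def leafCount {V : Type*} (k : ℕ) (Vset : ℕ → Set V) (i : ℕ) : ℕ :=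
  if i ≤ k then (Vset i).ncard else 0

theorem exists_index {V : Type*} {G : SimpleGraph V} {k : ℕ} {p : ℕ → V} {Vset : ℕ → Set V}
    (hcat : IsCaterpillar G k p Vset) :
    ∃ idx : V → ℕ, (∀ i ≤ k, idx (p i) = i) ∧
      (∀ i ≤ k, ∀ v ∈ Vset i, idx v = i ∧ ∀ j ≤ k, v ≠ p j) ∧
      ∀ v, idx v ≤ k ∧ (v = p (idx v) ∨ v ∈ Vset (idx v)) := by
  obtain ⟨hinj, hp, hdisj, hcov, -⟩ := hcat
  have h : ∀ v, ∃ i, i ≤ k ∧ (v = p i ∨ v ∈ Vset i) := by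
    intro v
    rcases hcov v with ⟨i, hi, h⟩ | ⟨i, hi, h⟩
    · exact ⟨i, hi, Or.inl h⟩
    · exact ⟨i, hi, Or.inr h⟩
  choose idx hidx using h
  refine ⟨idx, fun i hi => ?_, fun i hi v hv => ⟨?_, ?_⟩, hidx⟩
  · rcases (hidx (p i)).2 with h | h
    · exact (hinj _ _ hi (hidx _).1 h).symm
    · exact absurd h (hp _ _ hi (hidx _).1)
  · rcases (hidx v).2 with h | h
    · exact absurd (h ▸ hv) (hp _ _ (hidx _).1 hi)
    · by_contra hne
      exact (Set.disjoint_left.1 (hdisj _ _ (hidx v).1 hi hne)) h hv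
  · rintro j hj rfl
    exact hp _ _ hj hi hv

/-- `v` lies in the part of the caterpillar spanned by the steps `a, …, b`, where step `c` leads
from the `(c - 1)`-st path vertex to the `c`-th one. -/
def InRun {V : Type*} (k : ℕ) (p : ℕ → V) (Vset : ℕ → Set V) (a b : ℕ) (v : V) : Prop :=
  ∃ i ≤ k, (v = p i ∧ a ≤ i + 1 ∧ i ≤ b) ∨ (v ∈ Vset i ∧ a ≤ i ∧ i + 1 ≤ b)

theorem InRun.mono {V : Type*} {k : ℕ} {p : ℕ → V} {Vset : ℕ → Set V} {a b a' b' : ℕ} {v : V}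
    (h : InRun k p Vset a b v) (ha : a' ≤ a) (hb : b ≤ b') : InRun k p Vset a' b' v := by
  obtain ⟨i, hi, ⟨h1, h2, h3⟩ | ⟨h1, h2, h3⟩⟩ := h
  · exact ⟨i, hi, Or.inl ⟨h1, by omega, by omega⟩⟩
  · exact ⟨i, hi, Or.inr ⟨h1, by omega, by omega⟩⟩

theorem InRun.exists_chain {V : Type*} {G : SimpleGraph V} {k : ℕ} {p : ℕ → V}
    {Vset : ℕ → Set V} (hcat : IsCaterpillar G k p Vset) {a b : ℕ} {x y : V}
    (hx : InRun k p Vset a b x) (hy : InRun k p Vset a b y) :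
    ∃ z : ℕ → V, ((z a = x ∧ z (b + 1) = y) ∨ (z a = y ∧ z (b + 1) = x)) ∧
      ∀ c, a ≤ c → c ≤ b → z c = z (c + 1) ∨ G.Adj (z c) (z (c + 1)) := by
  obtain ⟨α, hα, hx⟩ := hx
  obtain ⟨β, hβ, hy⟩ := hy
  wlog hαβ : α ≤ β generalizing x y α β
  · obtain ⟨z, hz, h⟩ := this β hβ hy α hα hx (by omega)
    exact ⟨z, hz.symm, h⟩
  have hadj := hcat.2.2.2.2
  refine ⟨fun c => if c ≤ α then x else if c ≤ β + 1 then p (c - 1) else y, Or.inl ⟨?_, ?_⟩, ?_⟩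
  · rcases hx with ⟨rfl, h1, h2⟩ | ⟨h0, h1, h2⟩
    · dsimp only
      split_ifs
      · rfl
      · congr 1; omega
      · omega
    · simp [h1]
  · dsimp only
    rw [if_neg (by omega)]
    rcases hy with ⟨rfl, h1, h2⟩ | ⟨h0, h1, h2⟩
    · split_ifs
      · congr 1; omega
      · rfl
    · rw [if_neg (by omega)]
  · intro c hac hcb
    rcases lt_trichotomy c α with hc | rfl | hc
    · exact Or.inl (by simp only [if_pos hc.le, if_pos (show c + 1 ≤ α from hc)])
    · simp only [le_refl, if_true, if_neg (show ¬ c + 1 ≤ c by omega),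
        if_pos (show c + 1 ≤ β + 1 by omega), Nat.add_sub_cancel]
      rcases hx with ⟨rfl, h1, h2⟩ | ⟨h0, h1, h2⟩
      · exact Or.inl rfl
      · exact Or.inr ((hadj _ _).2 (Or.inr ⟨c, hα, Or.inl ⟨h0, rfl⟩⟩))
    · simp only [if_neg (show ¬ c ≤ α by omega), if_neg (show ¬ c + 1 ≤ α by omega),
        Nat.add_sub_cancel]
      rcases lt_trichotomy c (β + 1) with hc' | rfl | hc'
      · rw [if_pos hc'.le, if_pos (show c + 1 ≤ β + 1 by omega)]
        obtain ⟨c, rfl⟩ : ∃ c', c = c' + 1 := ⟨c - 1, by omega⟩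
        exact Or.inr ((hadj _ _).2 (Or.inl ⟨c, by omega, Or.inl ⟨rfl, rfl⟩⟩))
      · rw [if_pos le_rfl, if_neg (by omega), Nat.add_sub_cancel]
        rcases hy with ⟨rfl, h1, h2⟩ | ⟨h0, h1, h2⟩
        · exact Or.inl rfl
        · exact Or.inr ((hadj _ _).2 (Or.inr ⟨β, hβ, Or.inr ⟨h0, rfl⟩⟩))
      · rw [if_neg (by omega), if_neg (by omega)]
        exact Or.inl rfl

/-- The gaps crossed by the part spanned by the steps `a, …, b` are crossed by a walk with one
edge per step. -/
theorem exists_spanning_chain {V : Type*} [Fintype V] {G : SimpleGraph V} {k : ℕ} {p : ℕ → V}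
    {Vset : ℕ → Set V} (hcat : IsCaterpillar G k p Vset) (pos : V → ℕ) (a b : ℕ) :
    ∃ z : ℕ → V, (∀ c, a ≤ c → c ≤ b → z c = z (c + 1) ∨ G.Adj (z c) (z (c + 1))) ∧
      ∀ u w g, a ≤ b → InRun k p Vset a b u → InRun k p Vset a b w → Crosses pos u w g →
        ∃ c, a ≤ c ∧ c ≤ b ∧ Crosses pos (z c) (z (c + 1)) g := by
  classical
  let T : Finset V := Finset.univ.filter (InRun k p Vset a b)
  by_cases hT : T.Nonempty ∧ a ≤ b
  · obtain ⟨hT, hab⟩ := hT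
    obtain ⟨x, hx, hxm⟩ := T.exists_min_image pos hT
    obtain ⟨y, hy, hym⟩ := T.exists_max_image pos hT
    have mT : ∀ v, v ∈ T ↔ InRun k p Vset a b v := by simp [T]
    obtain ⟨z, hz, hadj⟩ := InRun.exists_chain hcat ((mT x).1 hx) ((mT y).1 hy)
    refine ⟨z, hadj, fun u w g _ hu hw hg => ?_⟩
    have hc : Crosses pos (z a) (z (b + 1)) g := by
      have h1 := hxm u ((mT u).2 hu)
      have h2 := hxm w ((mT w).2 hw)
      have h3 := hym u ((mT u).2 hu)
      have h4 := hym w ((mT w).2 hw)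
      unfold Crosses at *
      rcases hz with ⟨e1, e2⟩ | ⟨e1, e2⟩ <;> rw [e1, e2] <;> omega
    obtain ⟨c, h1, h2, h3⟩ := exists_crosses_of_chain pos z (by omega) hc
    exact ⟨c, h1, by omega, h3⟩
  · refine ⟨fun _ => p 0, fun _ _ _ => Or.inl rfl, fun u w g hab hu hw _ => ?_⟩
    exact absurd ⟨⟨u, by simpa [T] using hu⟩, hab⟩ hT

theorem exists_maximal_runs (Y : Finset ℕ) :
    ∃ s t : ℕ → ℕ, ∀ c ∈ Y, s c ≤ c ∧ c ≤ t c ∧ (∀ j, s c ≤ j → j ≤ t c → j ∈ Y) ∧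
      ∀ a b, a ≤ c → c ≤ b → (∀ j, a ≤ j → j ≤ b → j ∈ Y) → s c ≤ a ∧ b ≤ t c := by
  classical
  have h : ∀ c, ∃ s t : ℕ, c ∈ Y → s ≤ c ∧ c ≤ t ∧ (∀ j, s ≤ j → j ≤ t → j ∈ Y) ∧
      ∀ a b, a ≤ c → c ≤ b → (∀ j, a ≤ j → j ≤ b → j ∈ Y) → s ≤ a ∧ b ≤ t := by
    intro c
    by_cases hc : c ∈ Y
    swap
    · exact ⟨0, 0, fun h => absurd h hc⟩
    have hself : ∀ j, c ≤ j → j ≤ c → j ∈ Y := fun j h1 h2 => (le_antisymm h1 h2) ▸ hc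
    obtain ⟨s, hs, hsm⟩ := (Y.filter fun a => a ≤ c ∧ ∀ j, a ≤ j → j ≤ c → j ∈ Y).exists_min_image
      id ⟨c, Finset.mem_filter.2 ⟨hc, le_rfl, hself⟩⟩
    obtain ⟨t, ht, htm⟩ := (Y.filter fun b => c ≤ b ∧ ∀ j, c ≤ j → j ≤ b → j ∈ Y).exists_max_image
      id ⟨c, Finset.mem_filter.2 ⟨hc, le_rfl, hself⟩⟩
    simp only [Finset.mem_filter, id] at hs hsm ht htm
    refine ⟨s, t, fun _ => ⟨hs.2.1, ht.2.1, fun j h1 h2 => ?_, fun a b ha hb hab => ⟨?_, ?_⟩⟩⟩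
    · rcases le_total j c with h | h
      · exact hs.2.2 j h1 h
      · exact ht.2.2 j h h2
    · exact hsm a ⟨hab a le_rfl (by omega), ha, fun j h1 h2 => hab j h1 (by omega)⟩
    · exact htm b ⟨hab b (by omega) le_rfl, hb, fun j h1 h2 => hab j (by omega) h2⟩
  choose s t hst using h
  exact ⟨s, t, hst⟩

theorem exists_edge_per_step {V : Type*} [Fintype V] {G : SimpleGraph V} {k : ℕ} {p : ℕ → V}
    {Vset : ℕ → Set V} (hcat : IsCaterpillar G k p Vset) (pos : V → ℕ) (Y : Finset ℕ) :
    ∃ u w : ℕ → V, (∀ c ∈ Y, u c = w c ∨ G.Adj (u c) (w c)) ∧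
      ∀ a b v v' g, a ≤ b → (∀ j, a ≤ j → j ≤ b → j ∈ Y) → InRun k p Vset a b v →
        InRun k p Vset a b v' → Crosses pos v v' g → ∃ c ∈ Y, Crosses pos (u c) (w c) g := by
  obtain ⟨s, t, hst⟩ := exists_maximal_runs Y
  choose z hz hcross using exists_spanning_chain hcat pos
  refine ⟨fun c => z (s c) (t c) c, fun c => z (s c) (t c) (c + 1), fun c hc => ?_, ?_⟩
  · obtain ⟨h1, h2, -⟩ := hst c hc
    exact hz _ _ c h1 h2
  · intro a b v v' g hab hY hv hv' hg
    obtain ⟨h1, h2, h3, h4⟩ := hst a (hY a le_rfl hab)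
    obtain ⟨h5, h6⟩ := h4 a b le_rfl hab hY
    obtain ⟨c, hc1, hc2, hc3⟩ := hcross (s a) (t a) v v' g (by omega) (hv.mono h5 h6)
      (hv'.mono h5 h6) hg
    have hcY := h3 c hc1 hc2
    obtain ⟨g1, g2, g3, g4⟩ := hst c hcY
    obtain ⟨e1, e2⟩ := g4 (s a) (t a) hc1 hc2 h3
    obtain ⟨e3, e4⟩ := h4 (s c) (t c) (by omega) (by omega) g3
    refine ⟨c, hcY, ?_⟩
    dsimp only
    rw [le_antisymm e1 e3, le_antisymm e4 e2]
    exact hc3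

/-- Counting gaps bridged by edges of length `h + 1` in an umbrella ordering. -/
theorem sum_step_sub_le {V : Type*} [Fintype V] {G H : SimpleGraph V} {k : ℕ}
    {p : ℕ → V} {Vset : ℕ → Set V} (hcat : IsCaterpillar G k p Vset) (hGH : G ≤ H)
    {pos : V → ℕ} {x : ℕ → V} (hlt : ∀ v, pos v < Fintype.card V)
    (hx : ∀ j < Fintype.card V, pos (x j) = j)
    (humb : ∀ u w i j, H.Adj u w → pos u ≤ i → i < j → j ≤ pos w → H.Adj (x i) (x j))
    {l : ℕ → ℕ} (hl : ∀ i, l i ≤ leafCount k Vset i)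
    (hmin : ∀ l' : ℕ → ℕ, (∀ i, l' i ≤ leafCount k Vset i) →
      energy k (leafCount k Vset) l ≤ energy k (leafCount k Vset) l') (h : ℕ) :
    ∑ c ∈ Finset.range (k + 2), (step k (leafCount k Vset) l c - h) ≤
      Set.ncard {j | j + h + 1 < Fintype.card V ∧ H.Adj (x j) (x (j + h + 1))} := by
  classical
  have hn : ∀ i, k < i → leafCount k Vset i = 0 := fun i hi => if_neg (by omega)
  obtain ⟨Y, hY, hY1, hY2, hY3, hY4⟩ := exists_tight_steps hl hn hmin h
  obtain ⟨idx, hip, hil, hidx⟩ := exists_index hcat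
  obtain ⟨u, w, huw, hcov⟩ := exists_edge_per_step hcat pos Y
  let P : Finset ℕ := Y.filter fun c => 1 ≤ c ∧ c ≤ k
  let I : Finset ℕ := (Finset.range (k + 1)).filter fun i => i ∈ Y ∧ i + 1 ∈ Y
  let D : Finset V := P.image p ∪ I.biUnion fun i => (Vset i).toFinset
  let par : V → V := fun v => if v = p (idx v) then p (idx v - 1) else p (idx v)
  have hDcases : ∀ v ∈ D, (∃ c ∈ P, v = p c ∧ par v = p (c - 1)) ∨
      (∃ i ∈ I, v ∈ Vset i ∧ par v = p i) := by
    intro v hv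
    simp only [D, Finset.mem_union, Finset.mem_image, Finset.mem_biUnion, Set.mem_toFinset] at hv
    rcases hv with ⟨c, hc, rfl⟩ | ⟨i, hi, hv⟩
    · left
      have hck := (Finset.mem_filter.1 hc).2.2
      exact ⟨c, hc, rfl, by simp only [par, hip c hck, if_true]⟩
    · right
      have hik : i ≤ k := by have := (Finset.mem_filter.1 hi).1; simp at this; omega
      obtain ⟨e1, e2⟩ := hil i hik v hv
      exact ⟨i, hi, hv, by simp only [par, e1, if_neg (e2 i hik)]⟩
  have hPk : ∀ c ∈ P, c ∈ Y ∧ 1 ≤ c ∧ c ≤ k := fun c hc => Finset.mem_filter.1 hc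
  have hIk : ∀ i ∈ I, i ≤ k ∧ i ∈ Y ∧ i + 1 ∈ Y := fun i hi => by
    have := Finset.mem_filter.1 hi
    exact ⟨by have := this.1; simp at this; omega, this.2⟩
  have hDcard : P.card + ∑ i ∈ I, leafCount k Vset i = D.card := by
    rw [Finset.card_union_of_disjoint, Finset.card_image_of_injOn, Finset.card_biUnion]
    · congr 1
      refine Finset.sum_congr rfl fun i hi => ?_
      rw [leafCount, if_pos (hIk i hi).1, Set.ncard_eq_toFinset_card']
    · intro i hi j hj hij
      show Disjoint _ _
      rw [Set.disjoint_toFinset]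
      exact hcat.2.2.1 i j (hIk i hi).1 (hIk j hj).1 hij
    · intro c hc c' hc' hcc
      exact hcat.1 _ _ (hPk c hc).2.2 (hPk c' hc').2.2 hcc
    · rw [Finset.disjoint_left]
      intro v hv hv'
      simp only [Finset.mem_image, Finset.mem_biUnion, Set.mem_toFinset] at hv hv'
      obtain ⟨c, hc, rfl⟩ := hv
      obtain ⟨i, hi, hv⟩ := hv'
      exact hcat.2.1 c i (hPk c hc).2.2 (hIk i hi).1 hv
  have hforest := card_le_card_crossed pos x hx D par
    (fun v => if v = p (idx v) then idx v else k + 1) (by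
      intro v hv
      rcases hDcases v hv with ⟨c, hc, rfl, e⟩ | ⟨i, hi, hvi, e⟩
      · have := hPk c hc
        rw [e]
        simp only [hip c this.2.2, hip (c - 1) (by omega), if_true]
        omega
      · have := hIk i hi
        obtain ⟨e1, e2⟩ := hil i this.1 v hvi
        rw [e]
        simp only [hip i this.1, if_true, e1, if_neg (e2 i this.1)]
        omega)
  set wide := {j | j + h + 1 < Fintype.card V ∧ H.Adj (x j) (x (j + h + 1))} with hwide
  have hwfin : wide.Finite := (Set.finite_lt_nat (Fintype.card V)).subset fun j hj => by
    have := hj.1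
    simp only [Set.mem_ofPred_eq]
    omega
  let top : ℕ → ℕ := fun c => max (pos (u c)) (pos (w c))
  let tails : Finset ℕ := Y.biUnion fun c => Finset.Ico (top c - h) (top c)
  have htails : tails.card ≤ Y.card * h := Finset.card_biUnion_le_card_mul _ _ _ fun c _ => by
    rw [Nat.card_Ico]; omega
  have hsub : {g | g < Fintype.card V ∧ ∃ v ∈ D, Crosses pos v (par v) g} ⊆
      wide ∪ (tails : Set ℕ) := by
    rintro g ⟨hgN, v, hv, hg⟩
    have hc : ∃ c ∈ Y, Crosses pos (u c) (w c) g := by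
      rcases hDcases v hv with ⟨c, hc, rfl, e⟩ | ⟨i, hi, hvi, e⟩
      · have := hPk c hc
        rw [e] at hg
        exact hcov c c _ _ g le_rfl (fun j h1 h2 => le_antisymm h1 h2 ▸ this.1)
          ⟨c, this.2.2, Or.inl ⟨rfl, by omega, le_rfl⟩⟩
          ⟨c - 1, by omega, Or.inl ⟨rfl, by omega, by omega⟩⟩ hg
      · have := hIk i hi
        rw [e] at hg
        refine hcov i (i + 1) _ _ g (by omega) (fun j h1 h2 => ?_)
          ⟨i, this.1, Or.inr ⟨hvi, le_rfl, le_rfl⟩⟩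
          ⟨i, this.1, Or.inl ⟨rfl, by omega, by omega⟩⟩ hg
        rcases h1.eq_or_lt with rfl | h1
        · exact this.2.1
        · obtain rfl : j = i + 1 := by omega
          exact this.2.2
    obtain ⟨c, hcY, hc⟩ := hc
    by_cases hgt : top c ≤ g + h
    · right
      simp only [tails, Finset.coe_biUnion, Set.mem_iUnion, Finset.mem_coe, Finset.mem_Ico]
      exact ⟨c, hcY, by omega, hc.2⟩
    · left
      have hne : u c ≠ w c := by
        intro he
        rw [Crosses, he] at hc
        omega
      have hadj : H.Adj (u c) (w c) := hGH ((huw c hcY).resolve_left hne)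
      have h1 := hlt (u c)
      have h2 := hlt (w c)
      simp only [top] at hgt
      refine ⟨by omega, ?_⟩
      unfold Crosses at hc
      rcases le_total (pos (u c)) (pos (w c)) with hle | hle
      · exact humb _ _ _ _ hadj (by omega) (by omega) (by omega)
      · exact humb _ _ _ _ hadj.symm (by omega) (by omega) (by omega)
  have hcard := (Set.ncard_le_ncard hsub (hwfin.union tails.finite_toSet)).trans
    (Set.ncard_union_le _ _)
  rw [Set.ncard_coe_finset] at hcard
  have hstep : ∑ c ∈ Y, step k (leafCount k Vset) l c ≤
      P.card + ∑ i ∈ I, leafCount k Vset i := sum_step_le hl hn hY hY3 hY4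
  have hsplit : ∑ c ∈ Finset.range (k + 2), (step k (leafCount k Vset) l c - h) + Y.card * h =
      ∑ c ∈ Y, step k (leafCount k Vset) l c := by
    rw [← Finset.sum_subset hY fun c hc hcY => ?_, ← smul_eq_mul, ← Finset.sum_const,
      ← Finset.sum_add_distrib]
    · exact Finset.sum_congr rfl fun c hc => by have := hY2 c hc; omega
    · by_contra hne
      exact hcY (hY1 c (Finset.mem_range.1 hc) (by omega))
  omega

theorem energy_le_ncard_edgeSet {V : Type*} [Fintype V] {G H : SimpleGraph V} {k : ℕ}
    {p : ℕ → V} {Vset : ℕ → Set V} (hcat : IsCaterpillar G k p Vset) (hGH : G ≤ H)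
    (hH : IsProperIntervalGraph H) {l : ℕ → ℕ} (hl : ∀ i, l i ≤ leafCount k Vset i)
    (hmin : ∀ l' : ℕ → ℕ, (∀ i, l' i ≤ leafCount k Vset i) →
      energy k (leafCount k Vset) l ≤ energy k (leafCount k Vset) l') :
    energy k (leafCount k Vset) l ≤ H.edgeSet.ncard := by
  have : Nonempty V := ⟨p 0⟩
  obtain ⟨a, b, -, hadj, hprop⟩ := hH
  obtain ⟨pos, x, hlt, -, hx, humb⟩ := exists_umbrella_ordering hadj hprop
  set M := ∑ c ∈ Finset.range (k + 2), step k (leafCount k Vset) l c with hM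
  calc energy k (leafCount k Vset) l
      ≤ ∑ c ∈ Finset.range (k + 2), ∑ h ∈ Finset.range M,
          (step k (leafCount k Vset) l c - h) :=
        Finset.sum_le_sum fun c hc => choose_two_le_sum_tsub _ _
          (Finset.single_le_sum (f := step k (leafCount k Vset) l) (fun _ _ => Nat.zero_le _) hc)
    _ = ∑ h ∈ Finset.range M, ∑ c ∈ Finset.range (k + 2),
          (step k (leafCount k Vset) l c - h) := Finset.sum_comm
    _ ≤ _ := Finset.sum_le_sum fun h _ => sum_step_sub_le hcat hGH hlt hx humb hl hmin h
    _ ≤ _ := sum_card_le_ncard_edgeSet H pos x hx M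

theorem exists_canonical_completion {V : Type*} [Fintype V] {G : SimpleGraph V} {k : ℕ}
    {p : ℕ → V} {Vset : ℕ → Set V} (hcat : IsCaterpillar G k p Vset) {l : ℕ → ℕ}
    (hl : ∀ i, l i ≤ leafCount k Vset i) :
    ∃ H : SimpleGraph V, G ≤ H ∧ IsProperIntervalGraph H ∧
      H.edgeSet.ncard ≤ energy k (leafCount k Vset) l ∧
      ∃ a b : V → ℝ,
        (∀ i, i ≤ k → a (p i) = (i : ℝ) ∧ b (p i) = (i : ℝ) + 1) ∧
        (∀ i, i ≤ k → ∀ v ∈ Vset i,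
          (a v = (i : ℝ) ∧ b v = (i : ℝ)) ∨ (a v = (i : ℝ) + 1 ∧ b v = (i : ℝ) + 1)) ∧
        (∀ u v : V, H.Adj u v ↔ u ≠ v ∧ a u ≤ b v ∧ a v ≤ b u) := by
  classical
  obtain ⟨idx, hip, hil, hidx⟩ := exists_index hcat
  have hS : ∀ i, ∃ S : Finset V, i ≤ k → S ⊆ (Vset i).toFinset ∧ S.card = l i := by
    intro i
    by_cases hi : i ≤ k
    · have h := hl i
      rw [leafCount, if_pos hi, Set.ncard_eq_toFinset_card'] at h
      obtain ⟨S, h1, h2⟩ := Finset.exists_subset_card_eq h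
      exact ⟨S, fun _ => ⟨h1, h2⟩⟩
    · exact ⟨∅, fun h => absurd h hi⟩
  choose S hS using hS
  let lo : V → ℕ := fun v => if v = p (idx v) then idx v else
    if v ∈ S (idx v) then idx v else idx v + 1
  let hi : V → ℕ := fun v => if v = p (idx v) then idx v + 1 else lo v
  have lop : ∀ i ≤ k, lo (p i) = i := fun i h => by simp [lo, hip i h]
  have hip' : ∀ i ≤ k, hi (p i) = i + 1 := fun i h => by simp [hi, hip i h]
  have lol : ∀ i ≤ k, ∀ v ∈ Vset i, lo v = if v ∈ S i then i else i + 1 := fun i h v hv => by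
    obtain ⟨e1, e2⟩ := hil i h v hv
    simp [lo, e1, e2 i h]
  have hil' : ∀ i ≤ k, ∀ v ∈ Vset i, hi v = lo v := fun i h v hv => by
    obtain ⟨e1, e2⟩ := hil i h v hv
    simp [hi, e1, e2 i h]
  let H : SimpleGraph V :=
    { Adj := fun u v => u ≠ v ∧ lo u ≤ hi v ∧ lo v ≤ hi u
      symm := ⟨fun u v h => ⟨h.1.symm, h.2.2, h.2.1⟩⟩
      loopless := ⟨fun u h => h.1 rfl⟩ }
  have hHadj : ∀ u v, H.Adj u v ↔ u ≠ v ∧ lo u ≤ hi v ∧ lo v ≤ hi u := fun u v => Iff.rfl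
  have hkind : ∀ v, hi v = lo v ∨ hi v = lo v + 1 := by
    intro v
    by_cases h : v = p (idx v)
    · right; simp [hi, lo, ← h]
    · left; simp [hi, h]
  refine ⟨H, ?_, ?_, ?_, fun v => lo v, fun v => hi v, ?_, ?_, ?_⟩
  · have hleaf : ∀ i ≤ k, ∀ v ∈ Vset i, H.Adj v (p i) := by
      intro i h v hv
      have e := lol i h v hv
      rw [hHadj, hil' i h v hv, lop i h, hip' i h]
      refine ⟨(hil i h v hv).2 i h, ?_⟩
      split_ifs at e <;> omega
    have hspine : ∀ i < k, H.Adj (p i) (p (i + 1)) := by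
      intro i h
      rw [hHadj, lop i h.le, lop (i + 1) h, hip' i h.le, hip' (i + 1) h]
      refine ⟨fun he => ?_, by omega, by omega⟩
      have := hcat.1 i (i + 1) h.le h he
      omega
    intro u w huw
    rcases (hcat.2.2.2.2 u w).1 huw with
      ⟨i, h, ⟨rfl, rfl⟩ | ⟨rfl, rfl⟩⟩ | ⟨i, h, ⟨hv, rfl⟩ | ⟨hv, rfl⟩⟩
    · exact hspine i h
    · exact (hspine i h).symm
    · exact hleaf i h u hv
    · exact (hleaf i h w hv).symm
  · refine ⟨fun v => if hi v = lo v then (lo v : ℝ) - 1 / 3 else lo v,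
      fun v => if hi v = lo v then (lo v : ℝ) + 1 / 3 else lo v + 1, ?_, ?_, ?_⟩
    · intro v
      dsimp only
      split_ifs <;> linarith
    · intro u v
      rw [hHadj]
      refine and_congr_right fun _ => ?_
      have key : ∀ s t : V, lo s ≤ hi t ↔
          (if hi s = lo s then (lo s : ℝ) - 1 / 3 else lo s) ≤
            (if hi t = lo t then (lo t : ℝ) + 1 / 3 else lo t + 1) := by
        intro s t
        have ht := hkind t
        constructor
        · intro h
          rcases ht with ht | ht
          · rw [ht] at h
            have : (lo s : ℝ) ≤ lo t := by exact_mod_cast h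
            split_ifs <;> linarith
          · rw [ht] at h
            have : (lo s : ℝ) ≤ lo t + 1 := by exact_mod_cast h
            rw [if_neg (show ¬ hi t = lo t by omega)]
            split_ifs <;> linarith
        · intro h
          by_contra hlt
          rcases ht with ht | ht
          · have : (lo t : ℝ) + 1 ≤ lo s := by rw [ht] at hlt; exact_mod_cast not_le.1 hlt
            rw [if_pos ht] at h
            split_ifs at h <;> linarith
          · have : (lo t : ℝ) + 1 + 1 ≤ lo s := by rw [ht] at hlt; exact_mod_cast not_le.1 hlt
            rw [if_neg (show ¬ hi t = lo t by omega)] at h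
            split_ifs at h <;> linarith
      exact and_congr (key u v) (key v u)
    · intro u v h1 h2
      dsimp only at h1 h2 ⊢
      split_ifs at h1 h2 ⊢ with hu hv hv
      · constructor <;> linarith
      · linarith
      · have : lo u < lo v := by
          have : (lo u : ℝ) < lo v := by linarith
          exact_mod_cast this
        have : lo v < lo u + 1 := by
          have : (lo v : ℝ) < lo u + 1 := by linarith
          exact_mod_cast this
        omega
      · constructor <;> linarith
  · let K : ℕ → Finset V := fun c => Finset.univ.filter fun v => lo v ≤ c ∧ c ≤ hi v
    have hK : ∀ c < k + 2, (K c).card ≤ step k (leafCount k Vset) l c + 1 := by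
      intro c hc
      let A : Finset V := if c ≤ k then insert (p c) (S c) else ∅
      let B : Finset V := if 1 ≤ c then
        insert (p (c - 1)) ((Vset (c - 1)).toFinset \ S (c - 1)) else ∅
      have hsub : K c ⊆ A ∪ B := by
        intro v hv
        have hv := (Finset.mem_filter.1 hv).2
        obtain ⟨hk, h | h⟩ := hidx v
        · have e1 := lop _ hk
          have e2 := hip' _ hk
          rw [← h] at e1 e2
          rw [e1, e2] at hv
          rcases hv.1.eq_or_lt with e | e
          · refine Finset.mem_union_left _ ?_
            simp only [A]
            rw [if_pos (by omega), ← e, ← h]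
            exact Finset.mem_insert_self _ _
          · refine Finset.mem_union_right _ ?_
            simp only [B]
            rw [if_pos (by omega), show c - 1 = idx v by omega, ← h]
            exact Finset.mem_insert_self _ _
        · have e1 := lol _ hk v h
          rw [hil' _ hk v h] at hv
          have e := le_antisymm hv.1 hv.2
          rw [e] at e1
          split_ifs at e1 with hs
          · refine Finset.mem_union_left _ ?_
            simp only [A]
            rw [if_pos (by omega), e1]
            exact Finset.mem_insert_of_mem hs
          · refine Finset.mem_union_right _ ?_
            simp only [B]
            rw [if_pos (by omega), show c - 1 = idx v by omega]
            exact Finset.mem_insert_of_mem (Finset.mem_sdiff.2 ⟨Set.mem_toFinset.2 h, hs⟩)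
      have hA : A.card ≤ (if c ≤ k then 1 else 0) + l c := by
        simp only [A]
        split_ifs with h
        · have := Finset.card_insert_le (p c) (S c)
          rw [(hS c h).2] at this
          omega
        · simp
      have hB : B.card ≤ if 1 ≤ c then 1 + (leafCount k Vset (c - 1) - l (c - 1)) else 0 := by
        simp only [B]
        split_ifs with h
        · have := Finset.card_insert_le (p (c - 1)) ((Vset (c - 1)).toFinset \ S (c - 1))
          have hk : c - 1 ≤ k := by omega
          rw [Finset.card_sdiff_of_subset (hS _ hk).1, (hS _ hk).2,
            ← Set.ncard_eq_toFinset_card'] at this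
          rw [leafCount, if_pos hk]
          omega
        · simp
      refine (Finset.card_le_card hsub).trans ((Finset.card_union_le _ _).trans ?_)
      cases c with
      | zero => simp only [step]; simp at hA hB; simp [hB]; omega
      | succ c => simp only [step]; simp at hB; omega
    have hsub : H.edgeFinset ⊆ (Finset.range (k + 2)).biUnion fun c =>
        (K c).offDiag.image Sym2.mk.uncurry := by
      intro e
      induction e with | _ u v =>
      intro he
      rw [SimpleGraph.mem_edgeFinset, SimpleGraph.mem_edgeSet, hHadj] at he
      have h3 : ∀ v, lo v ≤ k + 1 := by
        intro v
        have := (hidx v).1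
        simp only [lo]
        split_ifs <;> omega
      have h1 := h3 u
      have h2 := h3 v
      have hu := hkind u
      have hv := hkind v
      refine Finset.mem_biUnion.2 ⟨max (lo u) (lo v), Finset.mem_range.2 (by omega),
        Finset.mem_image.2 ⟨(u, v), ?_, rfl⟩⟩
      simp only [Finset.mem_offDiag, K, Finset.mem_filter, Finset.mem_univ, true_and]
      exact ⟨by omega, by omega, he.1⟩
    rw [← SimpleGraph.coe_edgeFinset, Set.ncard_coe_finset]
    refine (Finset.card_le_card hsub).trans (Finset.card_biUnion_le.trans ?_)
    refine Finset.sum_le_sum fun c hc => ?_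
    rw [Sym2.card_image_offDiag]
    exact Nat.choose_le_choose 2 (hK c (Finset.mem_range.1 hc))
  · intro i h
    simp [lop i h, hip' i h]
  · intro i h v hv
    dsimp only
    rw [hil' i h v hv, lol i h v hv]
    split_ifs
    · exact Or.inl ⟨rfl, rfl⟩
    · exact Or.inr ⟨by push_cast; rfl, by push_cast; rfl⟩
  · intro u v
    simp only [hHadj, Nat.cast_le]

end CaterpillarCompletion

/-- every caterpillar has a minimum proper interval completion `H`
admitting an interval model in which the `i`-th path vertex is the interval `[i, i+1]`
and each leaf-child of `p i` is a degenerate point at `i` or at `i + 1`. -/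
theorem caterpillar_canonical_minimum_completion {V : Type*} [Fintype V]
    (G : SimpleGraph V) (k : ℕ) (p : ℕ → V) (Vset : ℕ → Set V)
    (hcat : IsCaterpillar G k p Vset) :
    ∃ H : SimpleGraph V, G ≤ H ∧ IsProperIntervalGraph H ∧
      (H.edgeSet \ G.edgeSet).ncard = pigCompletionNumber G ∧
      ∃ a b : V → ℝ,
        (∀ i, i ≤ k → a (p i) = (i : ℝ) ∧ b (p i) = (i : ℝ) + 1) ∧
        (∀ i, i ≤ k → ∀ v ∈ Vset i,
          (a v = (i : ℝ) ∧ b v = (i : ℝ)) ∨ (a v = (i : ℝ) + 1 ∧ b v = (i : ℝ) + 1)) ∧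
        (∀ u v : V, H.Adj u v ↔ u ≠ v ∧ a u ≤ b v ∧ a v ≤ b u) := by
  classical
  obtain ⟨l, hl, hmin⟩ :=
    CaterpillarCompletion.exists_energy_min k (CaterpillarCompletion.leafCount k Vset)
  obtain ⟨H, hGH, hH, hcard, hrep⟩ :=
    CaterpillarCompletion.exists_canonical_completion hcat hl
  refine ⟨H, hGH, hH, ?_, hrep⟩
  have hfill : ∀ H' : SimpleGraph V, G ≤ H' →
      (H'.edgeSet \ G.edgeSet).ncard = H'.edgeSet.ncard - G.edgeSet.ncard := fun H' h =>
    Set.ncard_sdiff (SimpleGraph.edgeSet_mono h) (Set.toFinite _)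
  refine (IsLeast.csInf_eq (s := {m | ∃ H : SimpleGraph V, G ≤ H ∧ IsProperIntervalGraph H ∧
    (H.edgeSet \ G.edgeSet).ncard = m}) ⟨⟨H, hGH, hH, rfl⟩, ?_⟩).symm
  rintro m ⟨H', hGH', hH', rfl⟩
  rw [hfill H hGH, hfill H' hGH']
  exact Nat.sub_le_sub_right
    (hcard.trans (CaterpillarCompletion.energy_le_ncard_edgeSet hcat hGH' hH' hl hmin)) _
end
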